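/- arXiv:1811.00267 — 8 statements merged into one kernel-verified Lean document; each statement's English description precedes it below -/
import Mathlib

section
/- Let γ denote the standard Gaussian measure on ℝ (i.e. N a standard normal random variable) and fix α ∈ ℝ. Then, as ε → 0⁺, ε^{-2} · E[ exp(−N/ε) · (N + ε·α)⁺ ] converges to e^α / √(2π). Equivalently, E[ exp(−N/ε) · (N + ε·α)⁺ ] ∼ (ε²/√(2π)) · e^α as ε → 0⁺. -/
open MeasureTheory ProbabilityTheory Filter

lemma exp_neg_mul_posPart_eq_indicator :
    (fun u : ℝ => Real.exp (-u) * max u 0) =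
      (Set.Ioi (0 : ℝ)).indicator (fun u => Real.exp (-u) * u ^ ((2 : ℝ) - 1)) := by
  ext u
  by_cases hu : 0 < u
  · rw [Set.indicator_of_mem (Set.mem_Ioi.2 hu), max_eq_left hu.le]
    norm_num
  · rw [Set.indicator_of_notMem (by simpa using hu), max_eq_right (not_lt.1 hu), mul_zero]

lemma integrable_exp_neg_mul_posPart :
    Integrable (fun u : ℝ => Real.exp (-u) * max u 0) := by
  rw [exp_neg_mul_posPart_eq_indicator, integrable_indicator_iff measurableSet_Ioi]
  exact Real.GammaIntegral_convergent two_pos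

lemma integral_exp_neg_mul_posPart : ∫ u : ℝ, Real.exp (-u) * max u 0 = 1 := by
  rw [exp_neg_mul_posPart_eq_indicator, integral_indicator measurableSet_Ioi,
    ← Real.Gamma_eq_integral two_pos, Real.Gamma_two]

lemma continuous_gaussianPDFReal (μ : ℝ) (v : NNReal) : Continuous (gaussianPDFReal μ v) := by
  unfold gaussianPDFReal
  fun_prop

lemma gaussianPDFReal_le (μ : ℝ) (v : NNReal) (x : ℝ) :
    gaussianPDFReal μ v x ≤ gaussianPDFReal μ v μ := by
  simp only [gaussianPDFReal]
  gcongr _ * Real.exp (?_ / _)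
  nlinarith [sq_nonneg (x - μ)]

lemma integral_eq_mul_integral_comp_mul_sub (g : ℝ → ℝ) (a : ℝ) {ε : ℝ} (hε : 0 < ε) :
    ∫ x, g x = ε * ∫ u, g (ε * (u - a)) := by
  rw [integral_sub_right_eq_self (fun u => g (ε * u)) a, Measure.integral_comp_mul_left,
    abs_of_pos (inv_pos.2 hε), smul_eq_mul, mul_inv_cancel_left₀ hε.ne']

lemma scaled_integral_gaussianReal (α : ℝ) {ε : ℝ} (hε : 0 < ε) :
    (ε ^ 2)⁻¹ * ∫ x, Real.exp (-x / ε) * max (x + ε * α) 0 ∂(gaussianReal 0 1) =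
      ∫ u, gaussianPDFReal 0 1 (ε * (u - α)) * (Real.exp α * (Real.exp (-u) * max u 0)) := by
  rw [integral_gaussianReal_eq_integral_smul one_ne_zero,
    integral_eq_mul_integral_comp_mul_sub _ α hε, ← mul_assoc, ← integral_const_mul]
  congr 1 with u
  have hexp : -(ε * (u - α)) / ε = α + -u := by field_simp; ring
  have hmax : max (ε * (u - α) + ε * α) 0 = ε * max u 0 := by
    rw [mul_max_of_nonneg _ _ hε.le, mul_zero]; ring_nf
  rw [hexp, hmax, Real.exp_add, smul_eq_mul]
  field_simp

/-- Lemma 3.1 (lem:BS1): as ε → 0⁺,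
`ε⁻² ⬝ E[exp(−N/ε) ⬝ (N + εα)⁺] → e^α / √(2π)` for `N` standard normal. -/
theorem gaussian_laplace_limit (α : ℝ) :
    Tendsto
      (fun ε : ℝ =>
        (ε ^ 2)⁻¹ *
          ∫ x, Real.exp (-x / ε) * max (x + ε * α) 0 ∂(gaussianReal 0 1))
      (nhdsWithin 0 (Set.Ioi 0))
      (nhds (Real.exp α / Real.sqrt (2 * Real.pi))) := by
  have hcont := continuous_gaussianPDFReal 0 1
  have hlim : Real.exp α / Real.sqrt (2 * Real.pi) =
      ∫ u, gaussianPDFReal 0 1 0 * (Real.exp α * (Real.exp (-u) * max u 0)) := by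
    rw [integral_const_mul, integral_const_mul, integral_exp_neg_mul_posPart]
    simp [gaussianPDFReal, div_eq_inv_mul]
  rw [hlim]
  have heq : (fun ε : ℝ =>
      ∫ u, gaussianPDFReal 0 1 (ε * (u - α)) * (Real.exp α * (Real.exp (-u) * max u 0)))
      =ᶠ[nhdsWithin 0 (Set.Ioi 0)] fun ε : ℝ =>
        (ε ^ 2)⁻¹ * ∫ x, Real.exp (-x / ε) * max (x + ε * α) 0 ∂(gaussianReal 0 1) := by
    filter_upwards [self_mem_nhdsWithin] with ε hε using (scaled_integral_gaussianReal α hε).symm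
  refine Tendsto.congr' heq ?_
  refine tendsto_integral_filter_of_dominated_convergence
    (fun u => gaussianPDFReal 0 1 0 * (Real.exp α * (Real.exp (-u) * max u 0))) ?_ ?_
    ((integrable_exp_neg_mul_posPart.const_mul _).const_mul _) ?_
  · exact .of_forall fun ε => Continuous.aestronglyMeasurable (by fun_prop)
  · refine .of_forall fun ε => .of_forall fun u => ?_
    rw [Real.norm_of_nonneg (mul_nonneg (gaussianPDFReal_nonneg _ _ _) (by positivity))]
    exact mul_le_mul_of_nonneg_right (gaussianPDFReal_le 0 1 _) (by positivity)
  · refine .of_forall fun u => Tendsto.mul_const _ ?_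
    have h : Continuous fun ε : ℝ => gaussianPDFReal 0 1 (ε * (u - α)) := by fun_prop
    simpa using (h.tendsto 0).mono_left nhdsWithin_le_nhds
end

section
/- There exists a constant C > 0 such that for every α ∈ ℝ, every γ ∈ [0,1), every ε > 0, and N a standard normal random variable, the quantity Q := √(2π) · ε^{-2} · E[ exp(−N/ε) · (N + γ·|N| + ε·α)⁺ ] satisfies: Q ≤ max( (1−γ)·e^{α/(1−γ)} + 2γ , (1+γ)·e^{α/(1+γ)} ), and Q ≥ min( (1−γ)·e^{α/(1−γ)} + 2γ , (1+γ)·e^{α/(1+γ)} ) − ε² · ( C·(1+α²)·max( e^{α/(1−γ)}, e^{α/(1+γ)} ) + 6γ ). -/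
open MeasureTheory ProbabilityTheory Filter

lemma tendsto_cubic_mul_exp_neg_atTop (p q r s : ℝ) :
    Tendsto (fun y : ℝ => (p + q * y + r * y ^ 2 + s * y ^ 3) * Real.exp (-y)) atTop (nhds 0) := by
  have h := Real.tendsto_pow_mul_exp_neg_atTop_nhds_zero
  have := ((((h 0).const_mul p).add ((h 1).const_mul q)).add ((h 2).const_mul r)).add
    ((h 3).const_mul s)
  simp only [mul_zero, add_zero] at this
  refine this.congr fun y => ?_
  ring

lemma integrableOn_cubic_mul_exp_neg (p q r s L : ℝ) :
    IntegrableOn (fun y : ℝ => (p + q * y + r * y ^ 2 + s * y ^ 3) * Real.exp (-y))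
      (Set.Ioi L) := by
  have h (n : ℕ) : IntegrableOn (fun y : ℝ => y ^ n * Real.exp (-y)) (Set.Ioi L) := by
    refine integrable_of_isBigO_exp_neg (b := 1 / 2) (by norm_num) (by fun_prop) ?_
    refine ((isLittleO_pow_exp_pos_mul_atTop n (b := 1 / 2) (by norm_num)).isBigO.mul
      (Asymptotics.isBigO_refl (fun y : ℝ => Real.exp (-y)) atTop)).congr_right fun y => ?_
    rw [← Real.exp_add]
    ring_nf
  have := ((((h 0).const_mul p).add ((h 1).const_mul q)).add ((h 2).const_mul r)).add
    ((h 3).const_mul s)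
  refine IntegrableOn.congr_fun this (fun y _ => ?_) measurableSet_Ioi
  simp only [Pi.add_apply]
  ring

lemma integral_Ioi_cubic_mul_exp_neg (p q r s L : ℝ) :
    ∫ y in Set.Ioi L, (p + q * y + r * y ^ 2 + s * y ^ 3) * Real.exp (-y) =
      ((p + q * L + r * L ^ 2 + s * L ^ 3) + (q + 2 * r * L + 3 * s * L ^ 2)
        + (2 * r + 6 * s * L) + 6 * s) * Real.exp (-L) := by
  have hderiv (y : ℝ) : HasDerivAt (fun y : ℝ => ((-(p + q + 2 * r + 6 * s)) +
      (-(q + 2 * r + 6 * s)) * y + (-(r + 3 * s)) * y ^ 2 + (-s) * y ^ 3) * Real.exp (-y))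
      ((p + q * y + r * y ^ 2 + s * y ^ 3) * Real.exp (-y)) y := by
    have h1 := (((hasDerivAt_id y).const_mul (-(q + 2 * r + 6 * s))).const_add
      (-(p + q + 2 * r + 6 * s)))
    have h2 := ((h1.add ((hasDerivAt_pow 2 y).const_mul (-(r + 3 * s)))).add
      ((hasDerivAt_pow 3 y).const_mul (-s))).mul (hasDerivAt_neg y).exp
    refine h2.congr_deriv ?_
    simp
    ring
  rw [integral_Ioi_of_hasDerivAt_of_tendsto' (fun y _ => hderiv y)
    (integrableOn_cubic_mul_exp_neg p q r s L) (tendsto_cubic_mul_exp_neg_atTop _ _ _ _)]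
  ring

/-- Rescaling a standard Gaussian expectation against the exponential weight `exp (-x / ε)`. -/
lemma integral_exp_mul_gaussianReal_eq (α γ ε : ℝ) (hε : 0 < ε) :
    Real.sqrt (2 * Real.pi) * (ε ^ 2)⁻¹ *
        ∫ x, Real.exp (-x / ε) * max (x + γ * |x| + ε * α) 0 ∂(gaussianReal 0 1) =
      ∫ y, Real.exp (-y) * max (y + γ * |y| + α) 0 * Real.exp (-(ε ^ 2 * y ^ 2 / 2)) := by
  have hpi : Real.sqrt (2 * Real.pi) ≠ 0 := by positivity
  rw [integral_gaussianReal_eq_integral_smul one_ne_zero]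
  set g : ℝ → ℝ := fun x => gaussianPDFReal 0 1 x •
    (Real.exp (-x / ε) * max (x + γ * |x| + ε * α) 0) with hg
  have hcov : ∫ x, g x = ε * ∫ y, g (ε * y) := by
    rw [Measure.integral_comp_mul_left g ε, abs_of_pos (inv_pos.mpr hε), smul_eq_mul,
      mul_inv_cancel_left₀ hε.ne']
  rw [hcov, ← integral_const_mul, ← integral_const_mul]
  congr 1 with y
  have hmax : max (ε * y + γ * |ε * y| + ε * α) 0 = ε * max (y + γ * |y| + α) 0 := by
    rw [mul_max_of_nonneg _ _ hε.le, abs_mul, abs_of_pos hε]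
    ring_nf
  have harg : -(ε * y) / ε = -y := by field_simp
  simp only [hg, gaussianPDFReal, smul_eq_mul, hmax, harg]
  have hexp : -(ε * y - 0) ^ 2 / (2 * ((1 : NNReal) : ℝ)) = -(ε ^ 2 * y ^ 2 / 2) := by
    simp; ring
  rw [hexp, NNReal.coe_one, mul_one]
  field_simp

/-- Comparison of a nonnegative function with its Gaussian damping. -/
lemma integrable_mul_exp_neg_of_le {F H : ℝ → ℝ} {κ : ℝ} (hκ : 0 ≤ κ) (hF : Continuous F)
    (hF0 : ∀ y, 0 ≤ F y) (hFH : ∀ y, F y ≤ H y) (hH : Integrable H) :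
    Integrable (fun y => F y * Real.exp (-(κ * y ^ 2 / 2))) ∧
      ∫ y, F y * Real.exp (-(κ * y ^ 2 / 2)) ≤ ∫ y, H y := by
  have hle (y : ℝ) : F y * Real.exp (-(κ * y ^ 2 / 2)) ≤ H y :=
    (mul_le_of_le_one_right (hF0 y)
      (Real.exp_le_one_iff.mpr (neg_nonpos.mpr (by positivity)))).trans (hFH y)
  have hInt : Integrable (fun y => F y * Real.exp (-(κ * y ^ 2 / 2))) := by
    refine hH.mono' (by fun_prop) (ae_of_all _ fun y => ?_)
    rw [Real.norm_of_nonneg (mul_nonneg (hF0 y) (Real.exp_pos _).le)]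
    exact hle y
  exact ⟨hInt, integral_mono hInt hH hle⟩

lemma one_sub_mul_le_mul_exp_neg {a t : ℝ} (ha : 0 ≤ a) : (1 - t) * a ≤ a * Real.exp (-t) := by
  rw [mul_comm]
  gcongr
  exact Real.one_sub_le_exp_neg t

lemma one_add_mul_exp_div_le {α γ : ℝ} (hα : 0 ≤ α) (hγ0 : 0 ≤ γ) (hγ1 : γ ≤ 1) :
    (1 + γ) * Real.exp (α / (1 + γ)) ≤ 2 * γ + (1 - γ + γ * α) * Real.exp α := by
  obtain ⟨b, hb⟩ : ∃ b, b = α / (1 + γ) := ⟨_, rfl⟩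
  have hb0 : 0 ≤ b := by rw [hb]; positivity
  have hαb : α = b + γ * b := by rw [hb]; field_simp
  rw [← hb, hαb, Real.exp_add]
  have h1 := Real.add_one_le_exp (γ * b)
  have h2 : Real.exp b * (1 - b) ≤ 1 := by
    calc Real.exp b * (1 - b) ≤ Real.exp b * Real.exp (-b) := by
          gcongr; linarith [Real.add_one_le_exp (-b)]
      _ = 1 := by rw [← Real.exp_add]; simp
  have hc : 0 ≤ 1 - γ + γ * (b + γ * b) := by
    have : 0 ≤ γ * (b + γ * b) := by positivity
    linarith
  have h3 : (1 - γ + γ * (b + γ * b)) * (Real.exp b * (γ * b + 1)) ≤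
      (1 - γ + γ * (b + γ * b)) * (Real.exp b * Real.exp (γ * b)) := by gcongr
  have h4 : 0 ≤ Real.exp b * (γ ^ 2 * (1 + γ) * b ^ 2) := by positivity
  nlinarith [mul_le_mul_of_nonneg_left h2 hγ0]

lemma integrable_indicator_cubic (p q r s L : ℝ) :
    Integrable ((Set.Ioi L).indicator
      fun y : ℝ => (p + q * y + r * y ^ 2 + s * y ^ 3) * Real.exp (-y)) :=
  (integrableOn_cubic_mul_exp_neg p q r s L).integrable_indicator measurableSet_Ioi

lemma laplace_two_sided_of_neg {α γ ε : ℝ} (hα : α < 0) (hγ0 : 0 ≤ γ) (hγ1 : γ < 1) :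
    (∫ y, Real.exp (-y) * max (y + γ * |y| + α) 0 * Real.exp (-(ε ^ 2 * y ^ 2 / 2))
        ≤ (1 + γ) * Real.exp (α / (1 + γ))) ∧
      (1 + γ) * Real.exp (α / (1 + γ))
          - ε ^ 2 * (8 * (1 + α ^ 2) * Real.exp (α / (1 + γ)))
        ≤ ∫ y, Real.exp (-y) * max (y + γ * |y| + α) 0 * Real.exp (-(ε ^ 2 * y ^ 2 / 2)) := by
  obtain ⟨b, hb⟩ : ∃ b, b = α / (1 + γ) := ⟨_, rfl⟩
  have hαb : α = (1 + γ) * b := by rw [hb]; field_simp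
  have hb0 : b < 0 := by rw [hb]; exact div_neg_of_neg_of_pos hα (by linarith)
  rw [← hb]
  have hF (y : ℝ) : Real.exp (-y) * max (y + γ * |y| + α) 0 =
      (Set.Ioi (-b)).indicator (fun y : ℝ => (α + (1 + γ) * y + 0 * y ^ 2 + 0 * y ^ 3)
        * Real.exp (-y)) y := by
    by_cases hy : y ∈ Set.Ioi (-b)
    · rw [Set.indicator_of_mem hy]
      rw [Set.mem_Ioi] at hy
      rw [abs_of_pos (by linarith), max_eq_left (by rw [hαb]; nlinarith)]
      ring
    · rw [Set.indicator_of_notMem hy]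
      rw [Set.mem_Ioi, not_lt] at hy
      rw [max_eq_right, mul_zero]
      rcases le_total 0 y with h | h
      · rw [abs_of_nonneg h, hαb]; nlinarith
      · rw [abs_of_nonpos h]; nlinarith
  have hF0 (y : ℝ) : 0 ≤ Real.exp (-y) * max (y + γ * |y| + α) 0 := by positivity
  obtain ⟨hInt, hup⟩ := integrable_mul_exp_neg_of_le (sq_nonneg ε) (by fun_prop) hF0
    (fun y => (hF y).le) (integrable_indicator_cubic _ _ _ _ _)
  constructor
  · refine hup.trans (le_of_eq ?_)
    rw [integral_indicator measurableSet_Ioi, integral_Ioi_cubic_mul_exp_neg, hαb, neg_neg]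
    ring
  · have hlow := integral_mono (integrable_indicator_cubic α (1 + γ) (-(ε ^ 2 * α / 2))
      (-(ε ^ 2 * (1 + γ) / 2)) (-b)) hInt fun y => by
        refine le_trans (le_of_eq ?_) (one_sub_mul_le_mul_exp_neg (hF0 y))
        rw [hF y]
        by_cases hy : y ∈ Set.Ioi (-b)
        · rw [Set.indicator_of_mem hy, Set.indicator_of_mem hy]
          ring
        · rw [Set.indicator_of_notMem hy, Set.indicator_of_notMem hy, mul_zero]
    refine le_trans ?_ hlow
    rw [integral_indicator measurableSet_Ioi, integral_Ioi_cubic_mul_exp_neg, neg_neg]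
    have hsq : b ^ 2 ≤ α ^ 2 := by
      rw [hαb, mul_pow]
      exact le_mul_of_one_le_left (sq_nonneg b) (by nlinarith)
    have hpoly : (1 + γ) / 2 * (6 - 4 * b + b ^ 2) ≤ 8 * (1 + α ^ 2) := by
      have h1 : (1 + γ) / 2 * (6 - 4 * b + b ^ 2) ≤ 1 * (6 - 4 * b + b ^ 2) := by
        gcongr
        · nlinarith
        · linarith
      nlinarith [sq_nonneg (b + 1)]
    have := mul_le_mul_of_nonneg_left hpoly (mul_nonneg (sq_nonneg ε) (Real.exp_pos b).le)
    rw [hαb] at this ⊢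
    linarith

lemma laplace_two_sided_of_nonneg {α γ ε : ℝ} (hα : 0 ≤ α) (hγ0 : 0 ≤ γ) (hγ1 : γ < 1) :
    (∫ y, Real.exp (-y) * max (y + γ * |y| + α) 0 * Real.exp (-(ε ^ 2 * y ^ 2 / 2))
        ≤ (1 - γ) * Real.exp (α / (1 - γ)) + 2 * γ) ∧
      (1 + γ) * Real.exp (α / (1 + γ))
          - ε ^ 2 * (8 * (1 + α ^ 2) * Real.exp (α / (1 - γ)) + 6 * γ)
        ≤ ∫ y, Real.exp (-y) * max (y + γ * |y| + α) 0 * Real.exp (-(ε ^ 2 * y ^ 2 / 2)) := by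
  have hc : 0 < 1 - γ := by linarith
  obtain ⟨a, ha⟩ : ∃ a, a = α / (1 - γ) := ⟨_, rfl⟩
  have hαa : α = (1 - γ) * a := by rw [ha]; field_simp
  have ha0 : 0 ≤ a := by rw [ha]; positivity
  rw [← ha]
  have hF (y : ℝ) : Real.exp (-y) * max (y + γ * |y| + α) 0 =
      (Set.Ioi (-a)).indicator (fun y : ℝ => (α + (1 - γ) * y + 0 * y ^ 2 + 0 * y ^ 3)
        * Real.exp (-y)) y + (Set.Ioi 0).indicator (fun y : ℝ =>
        (0 + (2 * γ) * y + 0 * y ^ 2 + 0 * y ^ 3) * Real.exp (-y)) y := by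
    rcases le_or_gt y 0 with h0 | h0
    · rw [Set.indicator_of_notMem (s := Set.Ioi (0 : ℝ)) (by simpa using h0), abs_of_nonpos h0,
        add_zero]
      by_cases hy : y ∈ Set.Ioi (-a)
      · rw [Set.indicator_of_mem hy]
        rw [Set.mem_Ioi] at hy
        rw [max_eq_left (by rw [hαa]; nlinarith)]
        ring
      · rw [Set.indicator_of_notMem hy]
        rw [Set.mem_Ioi, not_lt] at hy
        rw [max_eq_right (by rw [hαa]; nlinarith), mul_zero]
    · rw [Set.indicator_of_mem (s := Set.Ioi (0 : ℝ)) h0, abs_of_pos h0,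
        Set.indicator_of_mem (Set.mem_Ioi.mpr (by linarith)), max_eq_left (by positivity)]
      ring
  have hF0 (y : ℝ) : 0 ≤ Real.exp (-y) * max (y + γ * |y| + α) 0 := by positivity
  obtain ⟨hInt, hup⟩ := integrable_mul_exp_neg_of_le (sq_nonneg ε) (by fun_prop) hF0
    (fun y => (hF y).le)
    ((integrable_indicator_cubic _ _ _ _ _).add (integrable_indicator_cubic _ _ _ _ _))
  constructor
  · refine hup.trans (le_of_eq ?_)
    rw [integral_add (integrable_indicator_cubic _ _ _ _ _) (integrable_indicator_cubic _ _ _ _ _),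
      integral_indicator measurableSet_Ioi, integral_indicator measurableSet_Ioi,
      integral_Ioi_cubic_mul_exp_neg, integral_Ioi_cubic_mul_exp_neg, hαa, neg_neg, neg_zero,
      Real.exp_zero]
    ring
  · -- Truncating at `-α` rather than `-a` keeps the error uniform as `γ → 1`.
    have hαa' : (1 + γ) * α ≤ a := by rw [hαa]; nlinarith [mul_nonneg (sq_nonneg γ) ha0]
    have hαle : α ≤ a := by nlinarith [mul_nonneg hγ0 hα]
    have hlow := integral_mono ((integrable_indicator_cubic α (1 - γ) (-(ε ^ 2 * α / 2))
      (-(ε ^ 2 * (1 - γ) / 2)) (-α)).add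
      (integrable_indicator_cubic 0 (2 * γ) 0 (-(ε ^ 2 * γ)) 0)) hInt fun y => by
        by_cases hy : y ∈ Set.Ioi (-α)
        · refine le_trans (le_of_eq ?_) (one_sub_mul_le_mul_exp_neg (hF0 y))
          rw [hF y, Pi.add_apply, Set.indicator_of_mem hy,
            Set.indicator_of_mem (s := Set.Ioi (-a)) (Set.Ioi_subset_Ioi (by linarith) hy)]
          by_cases h0 : y ∈ Set.Ioi (0 : ℝ)
          · rw [Set.indicator_of_mem h0, Set.indicator_of_mem h0]
            ring
          · rw [Set.indicator_of_notMem h0, Set.indicator_of_notMem h0]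
            ring
        · have h0 : y ∉ Set.Ioi (0 : ℝ) := by
            simp only [Set.mem_Ioi, not_lt] at hy ⊢; linarith
          rw [Pi.add_apply, Set.indicator_of_notMem hy, Set.indicator_of_notMem h0, add_zero]
          exact mul_nonneg (hF0 y) (Real.exp_pos _).le
    refine le_trans ?_ hlow
    simp only [Pi.add_apply]
    rw [integral_add (integrable_indicator_cubic _ _ _ _ _) (integrable_indicator_cubic _ _ _ _ _),
      integral_indicator measurableSet_Ioi, integral_indicator measurableSet_Ioi,
      integral_Ioi_cubic_mul_exp_neg, integral_Ioi_cubic_mul_exp_neg, neg_neg, neg_zero,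
      Real.exp_zero]
    have hmain := one_add_mul_exp_div_le hα hγ0 hγ1.le
    have hexp1 : Real.exp α ≤ Real.exp a := Real.exp_le_exp.mpr hαle
    have hexp2 : γ * α * Real.exp α ≤ Real.exp a := by
      calc γ * α * Real.exp α ≤ Real.exp (γ * α) * Real.exp α := by
            gcongr; linarith [Real.add_one_le_exp (γ * α)]
        _ = Real.exp (γ * α + α) := (Real.exp_add _ _).symm
        _ ≤ Real.exp a := Real.exp_le_exp.mpr (by linarith)
    have herr : (1 - γ) / 2 * (6 - 4 * α + α ^ 2) * Real.exp α
        + (α ^ 2 - 2 * α + 2) / 2 * (γ * α * Real.exp α) ≤ 8 * (1 + α ^ 2) * Real.exp a := by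
      have h1 : (1 - γ) / 2 * (6 - 4 * α + α ^ 2) * Real.exp α ≤
          1 * (6 - 4 * α + α ^ 2) * Real.exp a := by
        have : 0 ≤ 6 - 4 * α + α ^ 2 := by nlinarith [sq_nonneg (α - 2)]
        gcongr
        linarith
      have h2 : (α ^ 2 - 2 * α + 2) / 2 * (γ * α * Real.exp α) ≤
          (α ^ 2 - 2 * α + 2) / 2 * Real.exp a := by
        have : 0 ≤ α ^ 2 - 2 * α + 2 := by nlinarith [sq_nonneg (α - 1)]
        gcongr
      have h3 : (6 - 4 * α + α ^ 2 + (α ^ 2 - 2 * α + 2) / 2) * Real.exp a ≤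
          8 * (1 + α ^ 2) * Real.exp a := by
        gcongr
        nlinarith [sq_nonneg α]
      linarith
    have := mul_le_mul_of_nonneg_left herr (sq_nonneg ε)
    linarith

/-- Lemma lem:BSabs: non-asymptotic two-sided Gaussian estimate.  There is `C > 0`
such that for all `α ∈ ℝ`, `γ ∈ [0,1)`, `ε > 0`, with `N` standard normal,
`Q := √(2π) ε⁻² E[exp(−N/ε)(N + γ|N| + εα)⁺]` satisfies the stated bounds. -/
theorem gaussian_laplace_two_sided :
    ∃ C : ℝ, 0 < C ∧ ∀ (α γ ε : ℝ), γ ∈ Set.Ico (0 : ℝ) 1 → 0 < ε →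
      (Real.sqrt (2 * Real.pi) * (ε ^ 2)⁻¹ *
          ∫ x, Real.exp (-x / ε) * max (x + γ * |x| + ε * α) 0 ∂(gaussianReal 0 1)
        ≤ max ((1 - γ) * Real.exp (α / (1 - γ)) + 2 * γ)
            ((1 + γ) * Real.exp (α / (1 + γ)))) ∧
      (min ((1 - γ) * Real.exp (α / (1 - γ)) + 2 * γ)
            ((1 + γ) * Real.exp (α / (1 + γ)))
          - ε ^ 2 * (C * (1 + α ^ 2) *
              max (Real.exp (α / (1 - γ))) (Real.exp (α / (1 + γ))) + 6 * γ)
        ≤ Real.sqrt (2 * Real.pi) * (ε ^ 2)⁻¹ *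
            ∫ x, Real.exp (-x / ε) * max (x + γ * |x| + ε * α) 0 ∂(gaussianReal 0 1)) := by
  refine ⟨8, by norm_num, fun α γ ε ⟨hγ0, hγ1⟩ hε => ?_⟩
  rw [integral_exp_mul_gaussianReal_eq α γ ε hε]
  rcases lt_or_ge α 0 with hα | hα
  · obtain ⟨hup, hlow⟩ := laplace_two_sided_of_neg (ε := ε) hα hγ0 hγ1
    refine ⟨hup.trans (le_max_right _ _), le_trans ?_ hlow⟩
    gcongr
    · exact min_le_right _ _
    · refine le_add_of_le_of_nonneg ?_ (by positivity)
      gcongr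
      exact le_max_right _ _
  · obtain ⟨hup, hlow⟩ := laplace_two_sided_of_nonneg (ε := ε) hα hγ0 hγ1
    refine ⟨hup.trans (le_max_left _ _), le_trans ?_ hlow⟩
    gcongr
    · exact min_le_right _ _
    · exact le_max_left _ _
end

section
/- Let N be a standard normal random variable, and fix k > 0, σ > 0, μ ∈ ℝ. Then, as ε → 0⁺, E[ ( exp(ε²·μ + ε·σ·N) − e^k )⁺ ] ∼ exp( −k²/(2·ε²·σ²) ) · ε³ · ( σ³ · e^k · e^{k·μ/σ²} ) / ( k² · √(2π) ); that is, the ratio of the left-hand side to the right-hand side tends to 1 as ε → 0⁺. -/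
open MeasureTheory ProbabilityTheory Filter

/-- The call payoff density after centring at the strike and rescaling, at time `t`. -/
noncomputable def rescaledCallDensity (k σ μ t z : ℝ) : ℝ :=
  max ((Real.exp (t * (σ * z)) - 1) / t) 0 * Real.exp (-((k - t * μ) * z / σ) - t * z ^ 2 / 2)

theorem tendsto_exp_mul_sub_one_div (c : ℝ) :
    Tendsto (fun t : ℝ => (Real.exp (t * c) - 1) / t) (nhdsWithin 0 (Set.Ioi 0)) (nhds c) := by
  have h : HasDerivAt (fun t : ℝ => Real.exp (t * c)) c 0 := by
    simpa using ((hasDerivAt_id (0 : ℝ)).mul_const c).exp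
  have h2 := h.tendsto_slope_zero_right
  refine h2.congr fun t => ?_
  simp [div_eq_inv_mul]

theorem exp_sub_one_le_mul_exp (u : ℝ) : Real.exp u - 1 ≤ u * Real.exp u := by
  have h := Real.add_one_le_exp (-u)
  have h2 : Real.exp (-u) * Real.exp u = 1 := by rw [← Real.exp_add]; simp
  nlinarith [Real.exp_pos u]

theorem integral_mul_exp_neg_mul_Ioi {b : ℝ} (hb : 0 < b) :
    ∫ z in Set.Ioi (0 : ℝ), z * Real.exp (-(b * z)) = 1 / b ^ 2 := by
  have h := Real.integral_rpow_mul_exp_neg_mul_Ioi (a := 2) (r := b) (by norm_num) hb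
  have h2 : (2 : ℝ) - 1 = 1 := by norm_num
  simp only [h2, Real.rpow_one, Real.Gamma_two, mul_one, Real.rpow_two] at h
  rw [h, div_pow, one_pow]

theorem integrableOn_mul_exp_neg_mul_Ioi {b : ℝ} (hb : 0 < b) :
    IntegrableOn (fun z : ℝ => z * Real.exp (-(b * z))) (Set.Ioi 0) := by
  refine Integrable.of_integral_ne_zero ?_
  rw [integral_mul_exp_neg_mul_Ioi hb]
  positivity

theorem rescaledCallDensity_of_nonpos (k : ℝ) {σ : ℝ} (μ : ℝ) {t z : ℝ} (hσ : 0 < σ) (ht : 0 < t)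
    (hz : z ≤ 0) : rescaledCallDensity k σ μ t z = 0 := by
  have h1 : Real.exp (t * (σ * z)) ≤ 1 := by
    rw [Real.exp_le_one_iff]
    exact mul_nonpos_of_nonneg_of_nonpos ht.le (mul_nonpos_of_nonneg_of_nonpos hσ.le hz)
  have h2 : (Real.exp (t * (σ * z)) - 1) / t ≤ 0 :=
    div_nonpos_of_nonpos_of_nonneg (by linarith) ht.le
  simp [rescaledCallDensity, max_eq_right h2]

theorem rescaledCallDensity_nonneg (k σ μ t z : ℝ) : 0 ≤ rescaledCallDensity k σ μ t z :=
  mul_nonneg (le_max_right _ _) (Real.exp_pos _).le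

theorem rescaledCallDensity_le {k σ μ t z : ℝ} (hσ : 0 < σ) (ht : 0 < t) (hz : 0 < z)
    (hsmall : t * (σ + μ / σ) ≤ k / (2 * σ)) :
    rescaledCallDensity k σ μ t z ≤ σ * (z * Real.exp (-(k / (2 * σ) * z))) := by
  have h1 : max ((Real.exp (t * (σ * z)) - 1) / t) 0 ≤ σ * z * Real.exp (t * (σ * z)) := by
    refine max_le ?_ (by positivity)
    rw [div_le_iff₀ ht]
    linarith [exp_sub_one_le_mul_exp (t * (σ * z))]
  calc rescaledCallDensity k σ μ t z
      ≤ σ * z * Real.exp (t * (σ * z)) * Real.exp (-((k - t * μ) * z / σ) - t * z ^ 2 / 2) :=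
        mul_le_mul_of_nonneg_right h1 (Real.exp_pos _).le
    _ = σ * z * Real.exp (t * (σ * z) + (-((k - t * μ) * z / σ) - t * z ^ 2 / 2)) := by
        rw [mul_assoc, ← Real.exp_add]
    _ ≤ σ * z * Real.exp (-(k / (2 * σ) * z)) := by
        gcongr
        have h2 : t * (σ * z) + (-((k - t * μ) * z / σ) - t * z ^ 2 / 2) =
            t * (σ + μ / σ) * z - 2 * (k / (2 * σ) * z) - t * z ^ 2 / 2 := by
          field_simp
          ring
        have h3 := mul_le_mul_of_nonneg_right hsmall hz.le
        have h4 : 0 ≤ t * z ^ 2 / 2 := by positivity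
        linarith
    _ = _ := by ring

theorem tendsto_rescaledCallDensity (k : ℝ) {σ : ℝ} (μ : ℝ) (hσ : 0 < σ) (z : ℝ) :
    Tendsto (fun t => rescaledCallDensity k σ μ t z) (nhdsWithin 0 (Set.Ioi 0))
      (nhds ((Set.Ioi (0 : ℝ)).indicator (fun z => σ * (z * Real.exp (-(k / σ * z)))) z)) := by
  rcases le_or_gt z 0 with hz | hz
  · rw [Set.indicator_of_notMem (by simpa using hz)]
    refine tendsto_const_nhds.congr' ?_
    filter_upwards [self_mem_nhdsWithin] with t ht
    exact (rescaledCallDensity_of_nonpos k μ hσ ht hz).symm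
  · rw [Set.indicator_of_mem (by simpa using hz)]
    have h1 := (tendsto_exp_mul_sub_one_div (σ * z)).max (tendsto_const_nhds (x := (0 : ℝ)))
    rw [max_eq_left (by positivity)] at h1
    have h2 : Tendsto (fun t : ℝ => Real.exp (-((k - t * μ) * z / σ) - t * z ^ 2 / 2))
        (nhdsWithin 0 (Set.Ioi 0)) (nhds (Real.exp (-(k / σ * z)))) := by
      have hc : Continuous fun t : ℝ => Real.exp (-((k - t * μ) * z / σ) - t * z ^ 2 / 2) := by
        fun_prop
      have h3 := (hc.tendsto 0).mono_left (nhdsWithin_le_nhds (s := Set.Ioi 0))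
      convert h3 using 3
      ring
    rw [← mul_assoc]
    exact h1.mul h2

theorem tendsto_integral_rescaledCallDensity {k σ : ℝ} (μ : ℝ) (hk : 0 < k) (hσ : 0 < σ) :
    Tendsto (fun t => ∫ z, rescaledCallDensity k σ μ t z) (nhdsWithin 0 (Set.Ioi 0))
      (nhds (σ ^ 3 / k ^ 2)) := by
  have hlim : ∫ z, (Set.Ioi (0 : ℝ)).indicator (fun z => σ * (z * Real.exp (-(k / σ * z)))) z =
      σ ^ 3 / k ^ 2 := by
    rw [integral_indicator measurableSet_Ioi, integral_const_mul,
      integral_mul_exp_neg_mul_Ioi (by positivity)]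
    field_simp
  rw [← hlim]
  refine tendsto_integral_filter_of_dominated_convergence
    ((Set.Ioi (0 : ℝ)).indicator fun z => σ * (z * Real.exp (-(k / (2 * σ) * z)))) ?_ ?_ ?_ ?_
  · refine Eventually.of_forall fun t => Continuous.aestronglyMeasurable ?_
    unfold rescaledCallDensity
    fun_prop
  · have hsmall : ∀ᶠ t : ℝ in nhdsWithin 0 (Set.Ioi 0), t * (σ + μ / σ) ≤ k / (2 * σ) := by
      have hc : Continuous fun t : ℝ => t * (σ + μ / σ) := by fun_prop
      have h0 := (hc.tendsto 0).mono_left (nhdsWithin_le_nhds (s := Set.Ioi 0))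
      rw [zero_mul] at h0
      exact h0.eventually_le_const (by positivity)
    filter_upwards [hsmall, self_mem_nhdsWithin] with t ht ht0
    refine Eventually.of_forall fun z => ?_
    rw [Real.norm_of_nonneg (rescaledCallDensity_nonneg k σ μ t z)]
    rcases le_or_gt z 0 with hz | hz
    · rw [Set.indicator_of_notMem (by simpa using hz), rescaledCallDensity_of_nonpos k μ hσ ht0 hz]
    · rw [Set.indicator_of_mem (by simpa using hz)]
      exact rescaledCallDensity_le hσ ht0 hz ht
  · rw [integrable_indicator_iff measurableSet_Ioi]
    exact (integrableOn_mul_exp_neg_mul_Ioi (by positivity)).const_mul σ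
  · exact Eventually.of_forall fun z => tendsto_rescaledCallDensity k μ hσ z

theorem gaussianPDFReal_mul_call_payoff (k μ z : ℝ) {σ ε : ℝ} (hσ : 0 < σ) (hε : 0 < ε) :
    gaussianPDFReal 0 1 (ε * z + (k - ε ^ 2 * μ) / (ε * σ)) *
        max (Real.exp (ε ^ 2 * μ + ε * σ * (ε * z + (k - ε ^ 2 * μ) / (ε * σ))) - Real.exp k) 0 =
      (Real.exp (-k ^ 2 / (2 * ε ^ 2 * σ ^ 2)) * Real.exp (k * μ / σ ^ 2) *
          Real.exp (-(ε ^ 2 * μ ^ 2 / (2 * σ ^ 2))) / Real.sqrt (2 * Real.pi) *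
          Real.exp k * ε ^ 2) * rescaledCallDensity k σ μ (ε ^ 2) z := by
  have h1 : ε ^ 2 * μ + ε * σ * (ε * z + (k - ε ^ 2 * μ) / (ε * σ)) = k + ε ^ 2 * (σ * z) := by
    field_simp
    ring
  have h2 : max (Real.exp (k + ε ^ 2 * (σ * z)) - Real.exp k) 0 =
      Real.exp k * ε ^ 2 * max ((Real.exp (ε ^ 2 * (σ * z)) - 1) / ε ^ 2) 0 := by
    rw [mul_max_of_nonneg _ _ (by positivity), mul_zero, Real.exp_add]
    congr 1
    field_simp
  have h3 : gaussianPDFReal 0 1 (ε * z + (k - ε ^ 2 * μ) / (ε * σ)) =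
      Real.exp (-k ^ 2 / (2 * ε ^ 2 * σ ^ 2)) * Real.exp (k * μ / σ ^ 2) *
        Real.exp (-(ε ^ 2 * μ ^ 2 / (2 * σ ^ 2))) / Real.sqrt (2 * Real.pi) *
        Real.exp (-((k - ε ^ 2 * μ) * z / σ) - ε ^ 2 * z ^ 2 / 2) := by
    simp only [gaussianPDFReal, NNReal.coe_one, mul_one, sub_zero]
    rw [div_mul_eq_mul_div, ← Real.exp_add, ← Real.exp_add, ← Real.exp_add, inv_mul_eq_div]
    congr 2
    field_simp
    ring
  rw [h1, h2, h3, rescaledCallDensity]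
  ring

theorem integral_call_payoff_gaussianReal (k μ : ℝ) {σ ε : ℝ} (hσ : 0 < σ) (hε : 0 < ε) :
    ∫ x, max (Real.exp (ε ^ 2 * μ + ε * σ * x) - Real.exp k) 0 ∂(gaussianReal 0 1) =
      ε * ((Real.exp (-k ^ 2 / (2 * ε ^ 2 * σ ^ 2)) * Real.exp (k * μ / σ ^ 2) *
          Real.exp (-(ε ^ 2 * μ ^ 2 / (2 * σ ^ 2))) / Real.sqrt (2 * Real.pi) *
          Real.exp k * ε ^ 2) * ∫ z, rescaledCallDensity k σ μ (ε ^ 2) z) := by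
  rw [integral_gaussianReal_eq_integral_smul one_ne_zero, ← integral_const_mul]
  simp only [smul_eq_mul]
  simp_rw [← gaussianPDFReal_mul_call_payoff k μ _ hσ hε]
  set g : ℝ → ℝ := fun x => gaussianPDFReal 0 1 x *
    max (Real.exp (ε ^ 2 * μ + ε * σ * x) - Real.exp k) 0
  have h := Measure.integral_comp_mul_left
    (fun y => g (y + (k - ε ^ 2 * μ) / (ε * σ))) ε
  rw [integral_add_right_eq_self g, abs_of_pos (inv_pos.mpr hε), smul_eq_mul] at h
  change ∫ x, g x = ε * ∫ z, g (ε * z + (k - ε ^ 2 * μ) / (ε * σ))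
  rw [h, mul_inv_cancel_left₀ hε.ne']

/-- Precise Black–Scholes asymptotics (equation e:BScall): for `k > 0`, `σ > 0`,
`E[(exp(ε²μ + εσN) − e^k)⁺] ∼ exp(−k²/(2ε²σ²)) ε³ σ³ e^k e^{kμ/σ²} / (k² √(2π))`
as `ε → 0⁺`. -/
theorem blackScholes_call_asymptotics (k σ μ : ℝ) (hk : 0 < k) (hσ : 0 < σ) :
    Tendsto
      (fun ε : ℝ =>
        (∫ x, max (Real.exp (ε ^ 2 * μ + ε * σ * x) - Real.exp k) 0
            ∂(gaussianReal 0 1)) /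
          (Real.exp (-k ^ 2 / (2 * ε ^ 2 * σ ^ 2)) * ε ^ 3 *
            (σ ^ 3 * Real.exp k * Real.exp (k * μ / σ ^ 2)) /
              (k ^ 2 * Real.sqrt (2 * Real.pi))))
      (nhdsWithin 0 (Set.Ioi 0)) (nhds 1) := by
  have hsq : Tendsto (fun ε : ℝ => ε ^ 2) (nhdsWithin 0 (Set.Ioi 0))
      (nhdsWithin 0 (Set.Ioi 0)) := by
    refine tendsto_nhdsWithin_iff.mpr ⟨?_, ?_⟩
    · have h := ((continuous_pow 2 : Continuous fun ε : ℝ => ε ^ 2).tendsto 0).mono_left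
        (nhdsWithin_le_nhds (s := Set.Ioi 0))
      simpa using h
    · filter_upwards [self_mem_nhdsWithin] with ε hε
      exact pow_pos (Set.mem_Ioi.mp hε) 2
  have hexp : Tendsto (fun ε : ℝ => Real.exp (-(ε ^ 2 * μ ^ 2 / (2 * σ ^ 2))))
      (nhdsWithin 0 (Set.Ioi 0)) (nhds 1) := by
    have hc : Continuous fun ε : ℝ => Real.exp (-(ε ^ 2 * μ ^ 2 / (2 * σ ^ 2))) := by fun_prop
    simpa using (hc.tendsto 0).mono_left (nhdsWithin_le_nhds (s := Set.Ioi 0))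
  have hmain := (hexp.mul_const (k ^ 2 / σ ^ 3)).mul
    ((tendsto_integral_rescaledCallDensity μ hk hσ).comp hsq)
  have hone : 1 * (k ^ 2 / σ ^ 3) * (σ ^ 3 / k ^ 2) = 1 := by field_simp
  rw [hone] at hmain
  refine hmain.congr' ?_
  filter_upwards [self_mem_nhdsWithin] with ε hε
  have hε0 : 0 < ε := hε
  rw [integral_call_payoff_gaussianReal k μ hσ hε0, Function.comp_apply]
  have hE1 := (Real.exp_pos (-k ^ 2 / (2 * ε ^ 2 * σ ^ 2))).ne'
  have hE2 := (Real.exp_pos (k * μ / σ ^ 2)).ne'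
  have hE3 := (Real.exp_pos k).ne'
  have hpi : Real.sqrt (2 * Real.pi) ≠ 0 := by positivity
  generalize Real.exp (-k ^ 2 / (2 * ε ^ 2 * σ ^ 2)) = E1 at *
  generalize Real.exp (k * μ / σ ^ 2) = E2 at *
  generalize Real.exp k = E3 at *
  generalize Real.exp (-(ε ^ 2 * μ ^ 2 / (2 * σ ^ 2))) = E4 at *
  generalize Real.sqrt (2 * Real.pi) = P at *
  field_simp
end

section
/- Let H be a real Hilbert space and Φ : H → ℝ continuously (Fréchet) differentiable. Define Λ : ℝ → [0, ∞] by Λ(y) := inf{ (1/2)·‖h‖² : h ∈ H, Φ(h) = y }. Fix x ∈ ℝ and suppose: h⁰ ∈ H satisfies Φ(h⁰) = x and (1/2)·‖h⁰‖² = Λ(x) (so h⁰ is an optimal control); and Λ is real-valued and differentiable at x with derivative Λ'(x). Then for every h ∈ H, ⟨h⁰, h⟩ = Λ'(x) · DΦ(h⁰)(h). -/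
open scoped RealInnerProductSpace ENNReal

/-- Lemma lem:appendix-2 (i): first order optimality and the energy function.
If `Λ(y) = inf{½‖h‖² : Φ(h) = y}` (as an `[0,∞]`-valued infimum, here assumed to be
real-valued everywhere), `h⁰` is an optimal control for level `x`, and `Λ` is
differentiable at `x`, then `⟨h⁰, h⟩ = Λ'(x) · DΦ(h⁰)(h)` for all `h`. -/
theorem first_order_optimality_energy
    {H : Type*} [NormedAddCommGroup H] [InnerProductSpace ℝ H] [CompleteSpace H]
    (Φ : H → ℝ) (hΦ : ContDiff ℝ 1 Φ) (x : ℝ) (h0 : H)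
    (Λ : ℝ → ℝ) (Λ' : ℝ)
    (hΛnn : ∀ y, 0 ≤ Λ y)
    (hΛ : ∀ y : ℝ,
      (ENNReal.ofReal (Λ y)) = ⨅ (h : H) (_ : Φ h = y), ENNReal.ofReal ((1 / 2) * ‖h‖ ^ 2))
    (hx : Φ h0 = x) (hopt : (1 / 2) * ‖h0‖ ^ 2 = Λ x)
    (hderiv : HasDerivAt Λ Λ' x) :
    ∀ h : H, ⟪h0, h⟫ = Λ' * fderiv ℝ Φ h0 h := by
  intro h
  have energy_le (g : H) : Λ (Φ g) ≤ (1 / 2) * ‖g‖ ^ 2 := by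
    rw [← ENNReal.ofReal_le_ofReal_iff (by positivity), hΛ]
    exact iInf₂_le (f := fun (k : H) (_ : Φ k = Φ g) => ENNReal.ofReal ((1 / 2) * ‖k‖ ^ 2))
      g rfl
  have hline : HasDerivAt (fun t : ℝ => h0 + t • h) h 0 := by
    simpa using ((hasDerivAt_id (0 : ℝ)).smul_const h).const_add h0
  have hΦline : HasDerivAt (fun t : ℝ => Φ (h0 + t • h)) (fderiv ℝ Φ h0 h) 0 :=
    HasFDerivAt.comp_hasDerivAt_of_eq 0
      (hΦ.differentiable one_ne_zero h0).hasFDerivAt hline (by simp)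
  have hΛline : HasDerivAt (fun t : ℝ => Λ (Φ (h0 + t • h))) (Λ' * fderiv ℝ Φ h0 h) 0 :=
    HasDerivAt.comp_of_eq 0 hderiv hΦline (by simp [hx])
  have hnorm : HasDerivAt (fun t : ℝ => (1 / 2) * ‖h0 + t • h‖ ^ 2) ⟪h0, h⟫ 0 := by
    simpa [← mul_assoc] using hline.norm_sq.const_mul (1 / 2 : ℝ)
  have hmin : IsLocalMin
      (fun t : ℝ => (1 / 2) * ‖h0 + t • h‖ ^ 2 - Λ (Φ (h0 + t • h))) 0 := by
    refine Filter.Eventually.of_forall fun t => ?_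
    have hzero : (1 / 2) * ‖h0 + (0 : ℝ) • h‖ ^ 2 - Λ (Φ (h0 + (0 : ℝ) • h)) = 0 := by
      rw [zero_smul, add_zero, hx, hopt, sub_self]
    exact hzero.trans_le (sub_nonneg.2 (energy_le _))
  exact sub_eq_zero.1 (hmin.hasDerivAt_eq_zero (hnorm.sub hΛline))
end

section
/- Let H be a real Hilbert space, Φ : H → ℝ twice continuously (Fréchet) differentiable, h⁰ ∈ H, and q ∈ ℝ such that ⟨h⁰, w⟩ = q · DΦ(h⁰)(w) for all w ∈ H. Let k ∈ H satisfy DΦ(h⁰)(k) = 0. Suppose κ : ℝ → H satisfies κ(ε) = h⁰ + ε·k + r(ε) with ‖r(ε)‖/ε → 0 as ε → 0, and Φ(κ(ε)) = Φ(h⁰) for all ε. Then lim_{ε→0} ε^{-2} · ( ‖κ(ε)‖² − ‖h⁰‖² ) = ‖k‖² − q · D²Φ(h⁰)(k, k). -/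
open Filter Asymptotics
open scoped RealInnerProductSpace Topology

/-- Second order Taylor expansion with Peano remainder: only twice differentiability at the base
point, with a symmetric second derivative, is needed. -/
theorem isLittleO_taylor_two_of_isSymmSndFDerivAt
    {E F : Type*} [NormedAddCommGroup E] [NormedSpace ℝ E]
    [NormedAddCommGroup F] [NormedSpace ℝ F] {f : E → F} {x : E}
    (hf : ∀ᶠ y in 𝓝 x, DifferentiableAt ℝ f y) (hf' : DifferentiableAt ℝ (fderiv ℝ f) x)
    (hsymm : IsSymmSndFDerivAt ℝ f x) :
    (fun y => f y - f x - fderiv ℝ f x (y - x) -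
      (1 / 2 : ℝ) • fderiv ℝ (fderiv ℝ f) x (y - x) (y - x)) =o[𝓝 x]
      fun y => ‖y - x‖ ^ 2 := by
  set B := fderiv ℝ (fderiv ℝ f) x
  set g : E → F := fun y => f y - f x - fderiv ℝ f x (y - x) - (1 / 2 : ℝ) • B (y - x) (y - x)
    with hg
  have hgd : ∀ y, DifferentiableAt ℝ f y →
      HasFDerivAt g (fderiv ℝ f y - fderiv ℝ f x - B (y - x)) y := by
    intro y hy
    have hsub : HasFDerivAt (fun z : E => z - x) (ContinuousLinearMap.id ℝ E) y :=
      (hasFDerivAt_id y).sub_const x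
    have hlin := (fderiv ℝ f x).hasFDerivAt.comp y hsub
    have hquad := ((B.hasFDerivAt.comp y hsub).clm_apply hsub).const_smul (1 / 2 : ℝ)
    refine (((hy.hasFDerivAt.sub_const (f x)).sub hlin).sub hquad).congr_fderiv ?_
    ext v
    have hv : B v (y - x) = B (y - x) v := hsymm v (y - x)
    simp only [sub_apply, ContinuousLinearMap.comp_apply,
      smul_apply, add_apply,
      ContinuousLinearMap.flip_apply, ContinuousLinearMap.id_apply, Function.comp_apply, hv]
    module
  rw [isLittleO_iff]
  intro c hc
  obtain ⟨δ, hδ, hball⟩ := Metric.eventually_nhds_iff_ball.1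
    (hf.and (hf'.hasFDerivAt.isLittleO.def hc))
  filter_upwards [Metric.ball_mem_nhds x hδ] with y hy
  have hsub : Metric.closedBall x ‖y - x‖ ⊆ Metric.ball x δ :=
    Metric.closedBall_subset_ball (by rwa [← dist_eq_norm])
  have hmv := (convex_closedBall x ‖y - x‖).norm_image_sub_le_of_norm_hasFDerivWithin_le
    (fun z hz => (hgd z (hball z (hsub hz)).1).hasFDerivWithinAt)
    (fun z hz => (hball z (hsub hz)).2.trans
      (mul_le_mul_of_nonneg_left (by rwa [← dist_eq_norm]) hc.le))
    (Metric.mem_closedBall_self (norm_nonneg _))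
    (Metric.mem_closedBall.2 (dist_eq_norm y x).le)
  have hgx : g x = 0 := by simp [hg]
  rw [hgx, sub_zero] at hmv
  rw [Real.norm_of_nonneg (by positivity), sq, ← mul_assoc]
  exact hmv

/-- Second variation of the energy along the constraint manifold (Appendix B.2):
if `h⁰ = q · ∇Φ(h⁰)` (Lagrange condition), `DΦ(h⁰)(k) = 0`, and `κ(ε)` is a curve in
the level set `{Φ = Φ(h⁰)}` with `κ(ε) = h⁰ + ε k + o(ε)`, then
`ε⁻²(‖κ(ε)‖² − ‖h⁰‖²) → ‖k‖² − q · D²Φ(h⁰)(k,k)` as `ε → 0`. -/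
theorem second_variation_along_constraint
    {H : Type*} [NormedAddCommGroup H] [InnerProductSpace ℝ H] [CompleteSpace H]
    (Φ : H → ℝ) (hΦ : ContDiff ℝ 2 Φ) (h0 : H) (q : ℝ)
    (hlag : ∀ w : H, ⟪h0, w⟫ = q * fderiv ℝ Φ h0 w)
    (k : H) (hk : fderiv ℝ Φ h0 k = 0)
    (κ : ℝ → H)
    (hκ : (fun ε : ℝ => κ ε - h0 - ε • k) =o[𝓝 0] fun ε : ℝ => ε)
    (hconstraint : ∀ ε : ℝ, Φ (κ ε) = Φ h0) :
    Tendsto (fun ε : ℝ => (‖κ ε‖ ^ 2 - ‖h0‖ ^ 2) / ε ^ 2)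
      (nhdsWithin 0 {(0 : ℝ)}ᶜ)
      (nhds (‖k‖ ^ 2 - q * fderiv ℝ (fderiv ℝ Φ) h0 k k)) := by
  set B := fderiv ℝ (fderiv ℝ Φ) h0
  have hd : Differentiable ℝ Φ := hΦ.differentiable (by norm_num)
  have hd' : Differentiable ℝ (fderiv ℝ Φ) :=
    (hΦ.fderiv_right (m := 1) (by norm_num)).differentiable (by norm_num)
  have htaylor := isLittleO_taylor_two_of_isSymmSndFDerivAt (Eventually.of_forall hd) (hd' h0)
    (hΦ.contDiffAt.isSymmSndFDerivAt (by simp))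
  have hu : (fun ε => κ ε - h0) =O[𝓝 0] fun ε : ℝ => ε := by
    have hsmul : (fun ε : ℝ => ε • k) =O[𝓝 0] fun ε : ℝ => ε :=
      IsBigO.of_bound ‖k‖ (Eventually.of_forall fun ε => by rw [norm_smul, mul_comm])
    simpa using hκ.isBigO.add hsmul
  have hκ0 : Tendsto κ (𝓝 0) (𝓝 h0) :=
    tendsto_sub_nhds_zero_iff.1 (hu.trans_tendsto tendsto_id)
  have hrem := ((htaylor.comp_tendsto hκ0).trans_isBigO (hu.norm_left.pow 2)).mono
    (nhdsWithin_le_nhds (s := {(0 : ℝ)}ᶜ)) |>.tendsto_div_nhds_zero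
  have hv : Tendsto (fun ε : ℝ => ε⁻¹ • (κ ε - h0)) (𝓝[≠] 0) (𝓝 k) := by
    have h := (hκ.mono
      (nhdsWithin_le_nhds (s := {(0 : ℝ)}ᶜ))).tendsto_inv_smul_nhds_zero.add_const k
    rw [zero_add] at h
    refine h.congr' ?_
    filter_upwards [self_mem_nhdsWithin] with ε hε
    rw [smul_sub, inv_smul_smul₀ hε, sub_add_cancel]
  have hBv : Tendsto (fun ε : ℝ => B (ε⁻¹ • (κ ε - h0)) (ε⁻¹ • (κ ε - h0))) (𝓝[≠] 0)
      (𝓝 (B k k)) :=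
    ((B.continuous.clm_apply continuous_id).tendsto k).comp hv
  have hlim := ((hv.norm.pow 2).sub (hBv.const_mul q)).sub (hrem.const_mul (2 * q))
  rw [mul_zero, sub_zero] at hlim
  refine hlim.congr' ?_
  filter_upwards [self_mem_nhdsWithin] with ε hε
  have hε' : ε ≠ 0 := hε
  have hnorm := norm_add_sq_real h0 (κ ε - h0)
  rw [add_sub_cancel, hlag] at hnorm
  simp only [Function.comp_apply, hconstraint, map_smul, smul_apply,
    smul_eq_mul, norm_smul, norm_inv, mul_pow, inv_pow, Real.norm_eq_abs, sq_abs]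
  rw [hnorm]
  field_simp
  ring
end

section
/- Let H be a real Hilbert space, k ≥ 1 an integer, and Φ : H → ℝ of class C^{k+1} (Fréchet) on a neighborhood of h⁰ ∈ H. Let x := Φ(h⁰) and suppose: DΦ(h⁰) ≠ 0; there is q ∈ ℝ with ⟨h⁰, w⟩ = q·DΦ(h⁰)(w) for all w ∈ H; and there is c > 0 such that ‖w‖² − q·D²Φ(h⁰)(w, w) ≥ c·‖w‖² for all w ∈ H with DΦ(h⁰)(w) = 0 (nondegeneracy). Then there exist δ > 0, an open neighborhood V of x in ℝ, and a C^k map ĥ : V → H with ĥ(x) = h⁰, such that for every y ∈ V: Φ(ĥ(y)) = y and ĥ(y) is the unique minimizer of h ↦ (1/2)·‖h‖² over { h ∈ H : Φ(h) = y, ‖h − h⁰‖ < δ }. In particular y ↦ (1/2)·‖ĥ(y)‖² is C^k on V. -/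
open scoped RealInnerProductSpace

open Set Filter Topology

section Coercivity

variable {E : Type*} [NormedAddCommGroup E] [NormedSpace ℝ E]

/-- A bounded bilinear form that is coercive on the kernel of a nonzero functional `L` becomes
coercive on the whole space after adding a large multiple of `L ⊗ L`. -/
theorem exists_isCoercive_add_smul_of_coercive_ker
    (A : E →L[ℝ] E →L[ℝ] ℝ) (L : E →L[ℝ] ℝ) (hL : L ≠ 0) {c : ℝ} (hc : 0 < c)
    (hA : ∀ w, L w = 0 → c * ‖w‖ ^ 2 ≤ A w w) :
    ∃ M : ℝ, IsCoercive (A + M • L.smulRight L) := by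
  obtain ⟨g, hg⟩ : ∃ g, L g = 1 := by
    obtain ⟨v, hv⟩ : ∃ v, L v ≠ 0 := by
      by_contra! h
      exact hL (ContinuousLinearMap.ext h)
    exact ⟨(L v)⁻¹ • v, by simp [hv]⟩
  set K := ‖A‖
  set n := ‖g‖
  refine ⟨K * n ^ 2 + 2 * K ^ 2 * n ^ 2 / c + c * n ^ 2 / 2, c / 4, by positivity, fun w => ?_⟩
  set t := L w with ht
  set v := w - t • g with hv
  have hLv : L v = 0 := by simp [hv, hg, ht]
  have hw : w = v + t • g := by simp [hv]
  have hA1 : |A v g| ≤ K * ‖v‖ * n := by simpa using A.le_opNorm₂ v g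
  have hA2 : |A g v| ≤ K * n * ‖v‖ := by simpa using A.le_opNorm₂ g v
  have hA3 : |A g g| ≤ K * n * n := by simpa using A.le_opNorm₂ g g
  have hnorm : ‖w‖ ≤ ‖v‖ + |t| * n := by
    rw [hw]
    simpa [norm_smul] using norm_add_le v (t • g)
  have hAw : A w w = A v v + t * (A v g + A g v) + t ^ 2 * A g g := by
    rw [hw]
    simp
    ring
  have hcross : -(2 * |t| * (K * ‖v‖ * n)) ≤ t * (A v g + A g v) := by
    have h1 : |t * (A v g + A g v)| ≤ |t| * (2 * (K * ‖v‖ * n)) := by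
      rw [abs_mul]
      refine mul_le_mul_of_nonneg_left ?_ (abs_nonneg t)
      calc |A v g + A g v| ≤ |A v g| + |A g v| := abs_add_le _ _
        _ ≤ 2 * (K * ‖v‖ * n) := by linarith
    linarith [neg_abs_le (t * (A v g + A g v))]
  have hsq : -(t ^ 2 * (K * n * n)) ≤ t ^ 2 * A g g := by
    have := mul_le_mul_of_nonneg_left (neg_le_of_abs_le hA3) (sq_nonneg t)
    linarith
  have hv2 := hA v hLv
  have hyoung : 2 * |t| * (K * ‖v‖ * n) ≤ c / 2 * ‖v‖ ^ 2 + 2 * K ^ 2 * n ^ 2 / c * t ^ 2 := by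
    have h1 : c / 2 * ‖v‖ ^ 2 + 2 * K ^ 2 * n ^ 2 / c * t ^ 2 - 2 * |t| * (K * ‖v‖ * n)
        = (c * ‖v‖ - 2 * (K * n * |t|)) ^ 2 / (2 * c) := by
      rw [← sq_abs t]
      field_simp
      ring
    have h2 : 0 ≤ (c * ‖v‖ - 2 * (K * n * |t|)) ^ 2 / (2 * c) := by positivity
    linarith
  have hnorm2 : ‖w‖ * ‖w‖ ≤ 2 * (‖v‖ ^ 2 + t ^ 2 * n ^ 2) := by
    have h1 := mul_self_le_mul_self (norm_nonneg w) hnorm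
    have h2 := sq_nonneg (‖v‖ - |t| * n)
    rw [← sq_abs t]
    linarith
  have hgoal : (A + (K * n ^ 2 + 2 * K ^ 2 * n ^ 2 / c + c * n ^ 2 / 2) • L.smulRight L) w w
      = A w w + (K * n ^ 2 + 2 * K ^ 2 * n ^ 2 / c + c * n ^ 2 / 2) * t ^ 2 := by
    simp only [add_apply, smul_apply, ContinuousLinearMap.smulRight_apply, smul_eq_mul, ← ht]
    ring
  rw [hgoal, hAw, mul_assoc]
  have := mul_le_mul_of_nonneg_left hnorm2 (by positivity : 0 ≤ c / 4)
  linarith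

end Coercivity

section SaddlePoint

variable {H : Type*} [NormedAddCommGroup H] [InnerProductSpace ℝ H] [CompleteSpace H]

/-- Lax–Milgram: every continuous functional is represented by a coercive bilinear form. -/
theorem IsCoercive.exists_apply_eq {B : H →L[ℝ] H →L[ℝ] ℝ} (hB : IsCoercive B)
    (u : H →L[ℝ] ℝ) : ∃ v, B v = u := by
  refine ⟨hB.continuousLinearEquivOfBilin.symm ((InnerProductSpace.toDual ℝ H).symm u), ?_⟩
  ext w
  rw [← hB.continuousLinearEquivOfBilin_apply]
  simp

/-- The linearized Lagrange system `(w, s) ↦ (A w - s L, L w)`. -/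
noncomputable def saddleMap {E : Type*} [NormedAddCommGroup E] [NormedSpace ℝ E]
    (A : E →L[ℝ] E →L[ℝ] ℝ) (L : E →L[ℝ] ℝ) : E × ℝ →L[ℝ] (E →L[ℝ] ℝ) × ℝ :=
  (A.comp (.fst ℝ E ℝ) - (ContinuousLinearMap.snd ℝ E ℝ).smulRight L).prod
    (L.comp (.fst ℝ E ℝ))

theorem saddleMap_apply {E : Type*} [NormedAddCommGroup E] [NormedSpace ℝ E]
    (A : E →L[ℝ] E →L[ℝ] ℝ) (L : E →L[ℝ] ℝ) (w : E) (s : ℝ) :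
    saddleMap A L (w, s) = (A w - s • L, L w) := rfl

/-- The linearized Lagrange system is invertible when `A` is coercive on `ker L` and `L ≠ 0`. -/
theorem saddleMap_bijective (A : H →L[ℝ] H →L[ℝ] ℝ) (L : H →L[ℝ] ℝ) (hL : L ≠ 0)
    {c : ℝ} (hc : 0 < c) (hA : ∀ w, L w = 0 → c * ‖w‖ ^ 2 ≤ A w w) :
    Function.Bijective (saddleMap A L) := by
  constructor
  · rw [injective_iff_map_eq_zero]
    rintro ⟨w, s⟩ h
    rw [saddleMap_apply, Prod.mk_eq_zero] at h
    obtain ⟨h1, h2⟩ := h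
    have h3 : A w w = 0 := by
      simpa [h2] using congrArg (fun f : H →L[ℝ] ℝ => f w) h1
    have hw : w = 0 := by
      by_contra hne
      have := hA w h2
      have : 0 < c * ‖w‖ ^ 2 := by positivity
      linarith
    subst hw
    simpa [hL] using h1
  · rintro ⟨u, t⟩
    obtain ⟨M, hM⟩ := exists_isCoercive_add_smul_of_coercive_ker A L hL hc hA
    obtain ⟨w₁, hw₁⟩ := hM.exists_apply_eq u
    obtain ⟨w₂, hw₂⟩ := hM.exists_apply_eq L
    have hLw₂ : L w₂ ≠ 0 := by
      obtain ⟨C, hC, hCoer⟩ := hM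
      have hne : w₂ ≠ 0 := by
        rintro rfl
        exact hL (by simpa using hw₂.symm)
      have h1 := hCoer w₂
      rw [hw₂] at h1
      have : 0 < C * ‖w₂‖ * ‖w₂‖ := by positivity
      linarith
    set σ := (t - L w₁) / L w₂ with hσ
    have hLw : L (w₁ + σ • w₂) = t := by
      simp [hσ, hLw₂]
    refine ⟨(w₁ + σ • w₂, σ - M * t), ?_⟩
    rw [saddleMap_apply, hLw]
    congr 1
    have h : (A + M • L.smulRight L) (w₁ + σ • w₂) = u + σ • L := by
      rw [map_add, map_smul, hw₁, hw₂]
    have h' : (A + M • L.smulRight L) (w₁ + σ • w₂) = A (w₁ + σ • w₂) + (M * t) • L := by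
      rw [add_apply, smul_apply, ContinuousLinearMap.smulRight_apply, hLw, smul_smul]
    rw [eq_sub_of_add_eq (h'.symm.trans h)]
    module

end SaddlePoint

/-- A strictly monotone derivative along the segments issuing from a critical point of a function
on a convex set makes that point the unique minimizer. -/
theorem lt_of_isCritical_of_fderiv_strictMono {E : Type*} [NormedAddCommGroup E] [NormedSpace ℝ E]
    {S : Set E} (hS : Convex ℝ S) {P : E → ℝ} {P' : E → E →L[ℝ] ℝ}
    (hP : ∀ z ∈ S, HasFDerivAt P (P' z) z) {a b : E} (ha : a ∈ S) (hb : b ∈ S) (hab : b ≠ a)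
    (hcrit : P' a = 0) (hmono : ∀ z ∈ S, z ≠ a → 0 < (P' z - P' a) (z - a)) :
    P a < P b := by
  have hmem : ∀ t ∈ Icc (0 : ℝ) 1, a + t • (b - a) ∈ S := fun t ht =>
    hS.add_smul_sub_mem ha hb ht
  have hderiv : ∀ t ∈ Icc (0 : ℝ) 1,
      HasDerivAt (fun t : ℝ => P (a + t • (b - a))) (P' (a + t • (b - a)) (b - a)) t := by
    intro t ht
    refine (hP _ (hmem t ht)).comp_hasDerivAt t ?_
    simpa using ((hasDerivAt_id t).smul_const (b - a)).const_add a
  have hmonoOn : StrictMonoOn (fun t : ℝ => P (a + t • (b - a))) (Icc 0 1) := by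
    refine strictMonoOn_of_deriv_pos (convex_Icc 0 1)
      (fun t ht => (hderiv t ht).continuousAt.continuousWithinAt) fun t ht => ?_
    rw [interior_Icc] at ht
    have ht' : t ∈ Icc (0 : ℝ) 1 := Ioo_subset_Icc_self ht
    rw [(hderiv t ht').deriv]
    have h1 := hmono _ (hmem t ht') (by simp [ht.1.ne', sub_ne_zero.2 hab])
    rw [hcrit, sub_zero, add_sub_cancel_left, map_smul, smul_eq_mul] at h1
    exact pos_of_mul_pos_right h1 ht.1.le
  simpa using hmonoOn (left_mem_Icc.2 zero_le_one) (right_mem_Icc.2 zero_le_one) zero_lt_one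

/-- The real inner product as a continuous bilinear form. -/
noncomputable def realInnerCLM (H : Type*) [NormedAddCommGroup H] [InnerProductSpace ℝ H] :
    H →L[ℝ] H →L[ℝ] ℝ :=
  (innerₗ H).mkContinuous₂ 1 fun v w => by simpa using norm_inner_le_norm (𝕜 := ℝ) v w

theorem realInnerCLM_apply {H : Type*} [NormedAddCommGroup H] [InnerProductSpace ℝ H] (v w : H) :
    realInnerCLM H v w = ⟪v, w⟫ := rfl

section Lagrange

variable {H : Type*} [NormedAddCommGroup H] [InnerProductSpace ℝ H]

/-- The derivative in `h` of the augmented Lagrangian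
`‖h‖² / 2 - μ (Φ h - y) + M / 2 * (Φ h - y)²`, as a function of `(h, μ, y)`. -/
noncomputable def augmentedGradient (Φ : H → ℝ) (M : ℝ) (p : H × ℝ × ℝ) : H →L[ℝ] ℝ :=
  realInnerCLM H p.1 - (p.2.1 - M * (Φ p.1 - p.2.2)) • fderiv ℝ Φ p.1

theorem hasFDerivAt_augmentedLagrangian {Φ : H → ℝ} {h : H} (hΦ : DifferentiableAt ℝ Φ h)
    (M μ y : ℝ) :
    HasFDerivAt (fun h => (1 / 2) * ‖h‖ ^ 2 - μ * (Φ h - y) + M / 2 * (Φ h - y) ^ 2)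
      (augmentedGradient Φ M (h, μ, y)) h := by
  have h1 := ((hasStrictFDerivAt_norm_sq h).hasFDerivAt).const_mul (1 / 2 : ℝ)
  have h2 := hΦ.hasFDerivAt.sub_const y
  refine ((h1.sub (h2.const_mul μ)).add ((h2.pow 2).const_mul (M / 2))).congr_fderiv ?_
  ext w
  simp [augmentedGradient, realInnerCLM_apply]
  ring

/-- Near `(h₀, q, Φ h₀)` the augmented gradient is strictly monotone in `h`, provided the
augmented Hessian is coercive. -/
theorem exists_augmentedGradient_strictMono {Φ : H → ℝ} {h₀ : H}
    (hΦ : HasStrictFDerivAt Φ (fderiv ℝ Φ h₀) h₀)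
    (hΦ' : HasStrictFDerivAt (fderiv ℝ Φ) (fderiv ℝ (fderiv ℝ Φ) h₀) h₀) (q M : ℝ)
    (hcoer : IsCoercive (realInnerCLM H - q • fderiv ℝ (fderiv ℝ Φ) h₀ +
      M • (fderiv ℝ Φ h₀).smulRight (fderiv ℝ Φ h₀))) :
    ∃ δ > 0, ∀ a ∈ Metric.ball h₀ δ, ∀ b ∈ Metric.ball h₀ δ, ∀ μ ∈ Metric.ball q δ,
      ∀ y ∈ Metric.ball (Φ h₀) δ, b ≠ a →
      0 < (augmentedGradient Φ M (b, μ, y) - augmentedGradient Φ M (a, μ, y)) (b - a) := by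
  obtain ⟨C, hC, hcoer⟩ := hcoer
  set p₀ : H × ℝ × ℝ := (h₀, q, Φ h₀) with hp₀
  have hfst : HasStrictFDerivAt (fun p : H × ℝ × ℝ => p.1) (.fst ℝ H (ℝ × ℝ)) p₀ :=
    hasStrictFDerivAt_fst
  have hsnd : HasStrictFDerivAt (fun p : H × ℝ × ℝ => p.2) (.snd ℝ H (ℝ × ℝ)) p₀ :=
    hasStrictFDerivAt_snd
  have hμ : HasStrictFDerivAt (fun p : H × ℝ × ℝ => p.2.1) _ p₀ :=
    hasStrictFDerivAt_fst.comp p₀ hsnd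
  have hy : HasStrictFDerivAt (fun p : H × ℝ × ℝ => p.2.2) _ p₀ :=
    hasStrictFDerivAt_snd.comp p₀ hsnd
  have hΦp : HasStrictFDerivAt (fun p : H × ℝ × ℝ => Φ p.1) _ p₀ := hΦ.comp p₀ hfst
  have hΦp' : HasStrictFDerivAt (fun p : H × ℝ × ℝ => fderiv ℝ Φ p.1) _ p₀ := hΦ'.comp p₀ hfst
  have hJ : HasStrictFDerivAt (fun p : H × ℝ × ℝ => realInnerCLM H p.1) _ p₀ :=
    (realInnerCLM H).hasStrictFDerivAt.comp p₀ hfst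
  have hR : HasStrictFDerivAt (augmentedGradient Φ M) _ p₀ :=
    hJ.sub ((hμ.sub ((hΦp.sub hy).const_mul M)).smul hΦp')
  have hbound := hR.isLittleO.def (half_pos hC)
  rw [Metric.eventually_nhds_iff_ball] at hbound
  obtain ⟨δ, hδ, hbound⟩ := hbound
  refine ⟨δ, hδ, fun a ha b hb μ hμb y hyb hne => ?_⟩
  have h1 := hbound ((b, μ, y), (a, μ, y)) (by
    simp only [Metric.mem_ball, Prod.dist_eq, hp₀, max_lt_iff] at *
    tauto)
  simp only [Prod.mk_sub_mk, sub_self] at h1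
  have h2 := hcoer (b - a)
  have hne' : 0 < ‖b - a‖ := norm_pos_iff.2 (sub_ne_zero.2 hne)
  have hnorm : ‖((b - a, 0) : H × ℝ × ℝ)‖ = ‖b - a‖ := by simp [Prod.norm_def]
  rw [hnorm] at h1
  have h3 := (ContinuousLinearMap.le_opNorm _ (b - a)).trans
    (mul_le_mul_of_nonneg_right h1 hne'.le)
  have h4 := (abs_le.1 h3).1
  have h5 : 0 < C / 2 * ‖b - a‖ * ‖b - a‖ := by positivity
  simp [hp₀] at h4 h2 ⊢
  linarith

/-- The Lagrange stationarity system `(h, μ) ↦ (h - μ DΦ(h), Φ h)`. -/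
noncomputable def lagrangeMap (Φ : H → ℝ) (p : H × ℝ) : (H →L[ℝ] ℝ) × ℝ :=
  (realInnerCLM H p.1 - p.2 • fderiv ℝ Φ p.1, Φ p.1)

theorem hasFDerivAt_lagrangeMap {Φ : H → ℝ} {h : H} (hΦ : DifferentiableAt ℝ Φ h)
    (hΦ' : DifferentiableAt ℝ (fderiv ℝ Φ) h) (q : ℝ) :
    HasFDerivAt (lagrangeMap Φ)
      (saddleMap (realInnerCLM H - q • fderiv ℝ (fderiv ℝ Φ) h) (fderiv ℝ Φ h)) (h, q) := by
  have hfst : HasFDerivAt (fun p : H × ℝ => p.1) (.fst ℝ H ℝ) (h, q) := hasFDerivAt_fst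
  have hsnd : HasFDerivAt (fun p : H × ℝ => p.2) (.snd ℝ H ℝ) (h, q) := hasFDerivAt_snd
  have hΦp : HasFDerivAt (fun p : H × ℝ => Φ p.1) _ (h, q) :=
    hΦ.hasFDerivAt.comp (h, q) hfst
  have hΦp' : HasFDerivAt (fun p : H × ℝ => fderiv ℝ Φ p.1) _ (h, q) :=
    hΦ'.hasFDerivAt.comp (h, q) hfst
  have hJ : HasFDerivAt (fun p : H × ℝ => realInnerCLM H p.1) _ (h, q) :=
    (realInnerCLM H).hasFDerivAt.comp (h, q) hfst
  refine ((hJ.sub (hsnd.smul hΦp')).prodMk hΦp).congr_fderiv ?_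
  refine ContinuousLinearMap.ext fun ⟨w, s⟩ => ?_
  rw [saddleMap_apply]
  simp [sub_sub]

theorem contDiffAt_lagrangeMap {Φ : H → ℝ} {h : H} {k : ℕ}
    (hΦ : ContDiffAt ℝ (k + 1 : ℕ) Φ h) (q : ℝ) : ContDiffAt ℝ k (lagrangeMap Φ) (h, q) := by
  have hfst : ContDiffAt ℝ k (fun p : H × ℝ => p.1) (h, q) := contDiffAt_fst
  have hΦ0 : ContDiffAt ℝ k Φ h := hΦ.of_le (by exact_mod_cast k.le_succ)
  have hΦ' : ContDiffAt ℝ k (fderiv ℝ Φ) h := hΦ.fderiv_right (by norm_cast)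
  exact (((realInnerCLM H).contDiff.contDiffAt.comp (h, q) hfst).sub
    (contDiffAt_snd.smul (hΦ'.comp (h, q) hfst))).prodMk (hΦ0.comp (h, q) hfst)

end Lagrange

/-- Local form of Lemma lem:hx: under the Lagrange condition and nondegeneracy of the
second variation, the constrained energy minimizer depends `C^k`-smoothly on the
constraint level, and so does the energy. -/
theorem smooth_dependence_of_minimizer
    {H : Type*} [NormedAddCommGroup H] [InnerProductSpace ℝ H] [CompleteSpace H]
    (k : ℕ) (hk : 1 ≤ k) (Φ : H → ℝ) (h0 : H)
    (hΦ : ContDiffAt ℝ (k + 1 : ℕ) Φ h0)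
    (x : ℝ) (hx : Φ h0 = x)
    (hDne : fderiv ℝ Φ h0 ≠ 0)
    (q : ℝ) (hlag : ∀ w : H, ⟪h0, w⟫ = q * fderiv ℝ Φ h0 w)
    (c : ℝ) (hc : 0 < c)
    (hnondeg : ∀ w : H, fderiv ℝ Φ h0 w = 0 →
      c * ‖w‖ ^ 2 ≤ ‖w‖ ^ 2 - q * fderiv ℝ (fderiv ℝ Φ) h0 w w) :
    ∃ δ : ℝ, 0 < δ ∧ ∃ V : Set ℝ, IsOpen V ∧ x ∈ V ∧ ∃ hhat : ℝ → H,
      ContDiffOn ℝ k hhat V ∧ hhat x = h0 ∧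
      (∀ y ∈ V, Φ (hhat y) = y ∧ ‖hhat y - h0‖ < δ ∧
        ∀ h : H, Φ h = y → ‖h - h0‖ < δ → h ≠ hhat y →
          (1 / 2) * ‖hhat y‖ ^ 2 < (1 / 2) * ‖h‖ ^ 2) ∧
      ContDiffOn ℝ k (fun y => (1 / 2) * ‖hhat y‖ ^ 2) V := by
  subst hx
  have hk0 : (k : WithTop ℕ∞) ≠ 0 := by exact_mod_cast (by omega : k ≠ 0)
  have hk1 : ((k + 1 : ℕ) : WithTop ℕ∞) ≠ 0 := by exact_mod_cast k.succ_ne_zero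
  have hΦ' : ContDiffAt ℝ k (fderiv ℝ Φ) h0 := hΦ.fderiv_right (by norm_cast)
  have hcoer : ∀ w, fderiv ℝ Φ h0 w = 0 →
      c * ‖w‖ ^ 2 ≤ (realInnerCLM H - q • fderiv ℝ (fderiv ℝ Φ) h0) w w := fun w hw => by
    simpa [realInnerCLM_apply] using hnondeg w hw
  obtain ⟨M, hM⟩ := exists_isCoercive_add_smul_of_coercive_ker _ _ hDne hc hcoer
  obtain ⟨r, hr, hmono⟩ := exists_augmentedGradient_strictMono
    (hΦ.hasStrictFDerivAt hk1) (hΦ'.hasStrictFDerivAt hk0) q M hM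
  obtain ⟨ε, hε, hdiff⟩ := Metric.eventually_nhds_iff_ball.1 (hΦ.eventually (by simp))
  obtain ⟨hinj, hsurj⟩ := saddleMap_bijective _ _ hDne hc hcoer
  let e := ContinuousLinearEquiv.ofBijective _
    (LinearMap.ker_eq_bot.2 hinj) (LinearMap.range_eq_top.2 hsurj)
  have hG := contDiffAt_lagrangeMap hΦ q
  have hG' : HasFDerivAt (lagrangeMap Φ) (e : H × ℝ →L[ℝ] (H →L[ℝ] ℝ) × ℝ) (h0, q) :=
    (hasFDerivAt_lagrangeMap (hΦ.differentiableAt hk1) (hΦ'.differentiableAt hk0) q)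
  have hG0 : lagrangeMap Φ (h0, q) = (0, Φ h0) := by
    refine Prod.ext (ContinuousLinearMap.ext fun w => ?_) rfl
    simp [lagrangeMap, realInnerCLM_apply, hlag w]
  set γ := hG.localInverse hG' hk0
  have hγ0 : γ (0, Φ h0) = (h0, q) := by
    rw [← hG0]
    exact hG.localInverse_apply_image hG' hk0
  have hγsmooth : ContDiffAt ℝ k γ (0, Φ h0) := by
    rw [← hG0]
    exact hG.to_localInverse hG' hk0
  have hγinv : ∀ᶠ p in 𝓝 (0, Φ h0), lagrangeMap Φ (γ p) = p := by
    rw [← hG0]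
    exact (hG.hasStrictFDerivAt' hG' hk0).eventually_right_inverse
  have hcurve : ContDiffAt ℝ k (fun y : ℝ => γ (0, y)) (Φ h0) :=
    hγsmooth.comp (Φ h0) (contDiffAt_const.prodMk contDiffAt_id)
  set δ := min r ε
  have hδ0 : 0 < δ := lt_min hr hε
  have hnhds : ∀ᶠ y in 𝓝 (Φ h0), ContDiffAt ℝ k (fun y : ℝ => γ (0, y)) y ∧
      lagrangeMap Φ (γ (0, y)) = (0, y) ∧ γ (0, y) ∈ Metric.ball (h0, q) δ ∧
      y ∈ Metric.ball (Φ h0) r := by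
    refine (hcurve.eventually (by simp)).and (.and ?_ (.and ?_ (Metric.ball_mem_nhds _ hr)))
    · exact (Continuous.prodMk_right (0 : H →L[ℝ] ℝ)).continuousAt.eventually hγinv
    · refine hcurve.continuousAt.eventually_mem ?_
      rw [hγ0]
      exact Metric.ball_mem_nhds _ hδ0
  obtain ⟨V, hV, hVo, hxV⟩ := eventually_nhds_iff.1 hnhds
  have hsmooth : ContDiffOn ℝ k (fun y => (γ (0, y)).1) V := fun y hy =>
    (contDiffAt_fst.comp y (hV y hy).1).contDiffWithinAt
  refine ⟨δ, hδ0, V, hVo, hxV, fun y => (γ (0, y)).1, hsmooth, by simp [hγ0], fun y hy => ?_,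
    contDiffOn_const.mul (hsmooth.norm_sq ℝ)⟩
  obtain ⟨-, hsol, hball, hyr⟩ := hV y hy
  beta_reduce
  generalize γ (0, y) = p at hsol hball ⊢
  obtain ⟨a, μ⟩ := p
  obtain ⟨hstat, hcon⟩ := Prod.ext_iff.1 hsol
  simp only [lagrangeMap] at hstat hcon
  rw [← ball_prod_same, Set.mem_prod] at hball
  obtain ⟨ha, hμ⟩ := hball
  have hsub : Metric.ball h0 δ ⊆ Metric.ball h0 r := Metric.ball_subset_ball (min_le_left _ _)
  refine ⟨hcon, mem_ball_iff_norm.1 ha, fun h hh hhδ hne => ?_⟩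
  have key := lt_of_isCritical_of_fderiv_strictMono (convex_ball h0 δ)
    (fun z hz => hasFDerivAt_augmentedLagrangian
      ((hdiff z (Metric.ball_subset_ball (min_le_right _ _) hz)).differentiableAt hk1) M μ y)
    ha (mem_ball_iff_norm.2 hhδ) hne (by simpa [augmentedGradient, hcon] using hstat)
    fun z hz hza => hmono a (hsub ha) z (hsub hz) μ
      (Metric.ball_subset_ball (min_le_left _ _) hμ) y hyr hza
  simpa [hh, hcon] using key
end

section
/- Let N be a standard normal random variable and fix σ > 0, μ ∈ ℝ, k > 0. Then, as ε → 0⁺, E[ ( exp(ε²·μ + ε·σ·N) − e^k )⁺ ] ∼ exp( −k²/(2·ε²·σ²) ) · ε · σ · e^k · E[ exp( −k·N/(ε·σ) ) · ( N + ε·μ/σ )⁺ ]; that is, the ratio of the two sides converges to 1 as ε → 0⁺. -/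
open MeasureTheory ProbabilityTheory Filter

/-- An integral against the standard Gaussian, after the affine substitution `x = c + ε * z`. -/
lemma integral_gaussianReal_eq_integral_affine (f : ℝ → ℝ) (c : ℝ) {ε : ℝ} (hε : 0 < ε) :
    ∫ x, f x ∂(gaussianReal 0 1) =
      (√(2 * Real.pi))⁻¹ * ε * ∫ z, Real.exp (-(c + ε * z) ^ 2 / 2) * f (c + ε * z) := by
  rw [integral_gaussianReal_eq_integral_smul one_ne_zero]
  have h := Measure.integral_comp_mul_left
    (fun y : ℝ => Real.exp (-(c + y) ^ 2 / 2) * f (c + y)) ε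
  rw [h, integral_add_left_eq_self (fun y : ℝ => Real.exp (-y ^ 2 / 2) * f y) c,
    abs_of_pos (inv_pos.2 hε), smul_eq_mul, mul_assoc, mul_inv_cancel_left₀ hε.ne',
    ← integral_const_mul]
  simp [gaussianPDFReal, mul_assoc]

lemma integrable_exp_neg_mul_mul_max_zero {b : ℝ} (hb : 0 < b) :
    Integrable (fun z : ℝ => Real.exp (-(b * z)) * max z 0) := by
  have h : IntegrableOn (fun z : ℝ => Real.exp (-(b * z)) * max z 0) (Set.Ioi 0) := by
    refine (integrableOn_rpow_mul_exp_neg_mul_rpow (p := 1) (s := 1) (b := b)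
      (by norm_num) one_pos hb).congr_fun (fun z hz => ?_) measurableSet_Ioi
    simp [max_eq_left (le_of_lt (Set.mem_Ioi.1 hz)), mul_comm]
  refine (integrableOn_iff_integrable_of_support_subset fun z hz => ?_).1 h
  by_contra hz'
  exact hz (by simp [max_eq_right (Set.notMem_Ioi.1 hz')])

lemma integral_exp_neg_mul_mul_max_zero_pos {b : ℝ} (hb : 0 < b) :
    0 < ∫ z : ℝ, Real.exp (-(b * z)) * max z 0 :=
  integral_pos_of_integrable_nonneg_nonzero (x := 1) (by fun_prop)
    (integrable_exp_neg_mul_mul_max_zero hb) (fun z => by positivity) (by simp)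

lemma max_exp_mul_sub_one_div_le {a z t : ℝ} (ha : 0 ≤ a) (ht : 0 < t) :
    max ((Real.exp (t * a * z) - 1) / t) 0 ≤ a * max z 0 * Real.exp (t * a * max z 0) := by
  refine max_le ?_ (by positivity)
  rw [div_le_iff₀ ht]
  have hmono : Real.exp (t * a * z) ≤ Real.exp (t * a * max z 0) := by
    gcongr
    exact le_max_left z 0
  have h := Real.add_one_le_exp (-(t * a * max z 0))
  have h2 : Real.exp (-(t * a * max z 0)) * Real.exp (t * a * max z 0) = 1 := by
    rw [← Real.exp_add]; simp
  nlinarith [Real.exp_pos (t * a * max z 0)]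

lemma tendsto_exp_sq_mul_sub_one_div_sq (a : ℝ) :
    Tendsto (fun ε : ℝ => (Real.exp (ε ^ 2 * a) - 1) / ε ^ 2)
      (nhdsWithin 0 (Set.Ioi 0)) (nhds a) := by
  have h : HasDerivAt (fun t : ℝ => Real.exp (t * a)) a 0 := by
    simpa using ((hasDerivAt_id (0 : ℝ)).mul_const a).exp
  have hsq : Tendsto (fun ε : ℝ => ε ^ 2) (nhdsWithin 0 (Set.Ioi 0)) (nhdsWithin 0 {0}ᶜ) := by
    refine tendsto_nhdsWithin_iff.2 ⟨?_, ?_⟩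
    · exact ((continuous_pow 2).tendsto' (0 : ℝ) 0 (by simp)).mono_left nhdsWithin_le_nhds
    · filter_upwards [self_mem_nhdsWithin] with ε hε
      exact pow_ne_zero 2 (ne_of_gt hε)
  refine (h.tendsto_slope.comp hsq).congr fun ε => ?_
  simp [slope_def_field]

/-- Dominated convergence against a slowly varying Gaussian weight centred at `m`. -/
lemma tendsto_integral_exp_neg_mul_mul_gaussian_mul {a b m : ℝ} (hb : 0 < b)
    {g : ℝ → ℝ → ℝ} (hg_cont : ∀ ε, Continuous (g ε))
    (hg_bound : ∀ᶠ ε in nhdsWithin (0 : ℝ) (Set.Ioi 0), ∀ z,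
      |g ε z| ≤ a * max z 0 * Real.exp (b / 2 * max z 0))
    (hg_lim : ∀ z, Tendsto (fun ε => g ε z) (nhdsWithin 0 (Set.Ioi 0)) (nhds (a * max z 0))) :
    Tendsto
      (fun ε => ∫ z, Real.exp (-(b * z)) * Real.exp (-(ε * (z - m)) ^ 2 / 2) * g ε z)
      (nhdsWithin 0 (Set.Ioi 0)) (nhds (a * ∫ z, Real.exp (-(b * z)) * max z 0)) := by
  rw [← integral_const_mul]
  refine tendsto_integral_filter_of_dominated_convergence
    (fun z => a * (Real.exp (-(b / 2 * z)) * max z 0)) (.of_forall fun ε => ?_) ?_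
    ((integrable_exp_neg_mul_mul_max_zero (half_pos hb)).const_mul a)
    (.of_forall fun z => ?_)
  · have := hg_cont ε
    exact Continuous.aestronglyMeasurable (by fun_prop)
  · filter_upwards [hg_bound] with ε hε
    refine .of_forall fun z => ?_
    rw [Real.norm_eq_abs, abs_mul, abs_of_pos (by positivity)]
    calc Real.exp (-(b * z)) * Real.exp (-(ε * (z - m)) ^ 2 / 2) * |g ε z|
        ≤ Real.exp (-(b * z)) * 1 * (a * max z 0 * Real.exp (b / 2 * max z 0)) := by
          gcongr
          · exact Real.exp_le_one_iff.2 (by nlinarith [sq_nonneg (ε * (z - m))])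
          · exact hε z
      _ = a * (Real.exp (-(b / 2 * z)) * max z 0) := by
          rcases le_total z 0 with hz | hz
          · simp [max_eq_right hz]
          · rw [max_eq_left hz, show -(b / 2 * z) = -(b * z) + b / 2 * z by ring, Real.exp_add]
            ring
  · have h : Tendsto (fun ε : ℝ => Real.exp (-(b * z)) * Real.exp (-(ε * (z - m)) ^ 2 / 2))
        (nhdsWithin 0 (Set.Ioi 0)) (nhds (Real.exp (-(b * z)))) :=
      (Continuous.tendsto' (by fun_prop) 0 _ (by simp)).mono_left nhdsWithin_le_nhds
    convert h.mul (hg_lim z) using 2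
    ring

lemma integral_call_payoff_eq (σ μ k : ℝ) (hσ : 0 < σ) {ε : ℝ} (hε : 0 < ε) :
    ∫ x, max (Real.exp (ε ^ 2 * μ + ε * σ * x) - Real.exp k) 0 ∂(gaussianReal 0 1) =
      (√(2 * Real.pi))⁻¹ * ε * Real.exp (-k ^ 2 / (2 * ε ^ 2 * σ ^ 2)) * Real.exp k *
        Real.exp (k * μ / σ ^ 2) * ε ^ 2 *
        ∫ z, Real.exp (-(k / σ * z)) * Real.exp (-(ε * (z - μ / σ)) ^ 2 / 2) *
          max ((Real.exp (ε ^ 2 * σ * z) - 1) / ε ^ 2) 0 := by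
  rw [integral_gaussianReal_eq_integral_affine _ (k / (ε * σ) - ε * μ / σ) hε,
    ← integral_const_mul, ← integral_const_mul]
  refine integral_congr_ae (.of_forall fun z => ?_)
  have hexp : ε ^ 2 * μ + ε * σ * (k / (ε * σ) - ε * μ / σ + ε * z) = k + ε ^ 2 * σ * z := by
    field_simp
    ring
  have hmax : max (Real.exp (k + ε ^ 2 * σ * z) - Real.exp k) 0 =
      Real.exp k * (ε ^ 2 * max ((Real.exp (ε ^ 2 * σ * z) - 1) / ε ^ 2) 0) := by
    rw [mul_max_of_nonneg _ _ (by positivity), mul_max_of_nonneg _ _ (by positivity),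
      mul_div_cancel₀ _ (by positivity), Real.exp_add]
    simp [mul_sub]
  have hdens : Real.exp (-(k / (ε * σ) - ε * μ / σ + ε * z) ^ 2 / 2) =
      Real.exp (-k ^ 2 / (2 * ε ^ 2 * σ ^ 2)) * Real.exp (k * μ / σ ^ 2) *
        (Real.exp (-(k / σ * z)) * Real.exp (-(ε * (z - μ / σ)) ^ 2 / 2)) := by
    simp only [← Real.exp_add]
    congr 1
    field_simp
    ring
  simp only [hexp, hmax, hdens]
  ring

lemma integral_linearized_payoff_eq (σ μ k : ℝ) (hσ : 0 < σ) {ε : ℝ} (hε : 0 < ε) :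
    σ * ∫ x, Real.exp (-(k * x) / (ε * σ)) * max (x + ε * μ / σ) 0 ∂(gaussianReal 0 1) =
      (√(2 * Real.pi))⁻¹ * ε * Real.exp (k * μ / σ ^ 2) * ε *
        ∫ z, Real.exp (-(k / σ * z)) * Real.exp (-(ε * (z - μ / σ)) ^ 2 / 2) *
          (σ * max z 0) := by
  rw [integral_gaussianReal_eq_integral_affine _ (-(ε * μ / σ)) hε,
    ← integral_const_mul, ← integral_const_mul, ← integral_const_mul]
  refine integral_congr_ae (.of_forall fun z => ?_)
  have hmax : max (-(ε * μ / σ) + ε * z + ε * μ / σ) 0 = ε * max z 0 := by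
    rw [mul_max_of_nonneg _ _ hε.le]
    congr 1 <;> ring
  have hdens : Real.exp (-(k * (-(ε * μ / σ) + ε * z)) / (ε * σ)) =
      Real.exp (k * μ / σ ^ 2) * Real.exp (-(k / σ * z)) := by
    rw [← Real.exp_add]
    congr 1
    field_simp
    ring
  have hsq : -(ε * μ / σ) + ε * z = ε * (z - μ / σ) := by ring
  simp only [hmax, hdens]
  rw [hsq]
  ring

/-- Linearization step in Section 3: as `ε → 0⁺`,
`E[(exp(ε²μ + εσN) − e^k)⁺]
  ∼ exp(−k²/(2ε²σ²)) ε σ e^k E[exp(−kN/(εσ)) (N + εμ/σ)⁺]`. -/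
theorem blackScholes_linearization (σ μ k : ℝ) (hσ : 0 < σ) (hk : 0 < k) :
    Tendsto
      (fun ε : ℝ =>
        (∫ x, max (Real.exp (ε ^ 2 * μ + ε * σ * x) - Real.exp k) 0
            ∂(gaussianReal 0 1)) /
          (Real.exp (-k ^ 2 / (2 * ε ^ 2 * σ ^ 2)) * ε * σ * Real.exp k *
            ∫ x, Real.exp (-(k * x) / (ε * σ)) * max (x + ε * μ / σ) 0
              ∂(gaussianReal 0 1)))
      (nhdsWithin 0 (Set.Ioi 0)) (nhds 1) := by
  have hb : 0 < k / σ := div_pos hk hσ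
  have hnum := tendsto_integral_exp_neg_mul_mul_gaussian_mul (a := σ) (m := μ / σ) hb
    (g := fun ε z => max ((Real.exp (ε ^ 2 * σ * z) - 1) / ε ^ 2) 0) (fun ε => by fun_prop)
    (by
      have hsmall : ∀ᶠ ε in nhdsWithin (0 : ℝ) (Set.Ioi 0), ε ^ 2 * σ < k / σ / 2 :=
        ((Continuous.tendsto' (by fun_prop) 0 0 (by simp)).mono_left
          nhdsWithin_le_nhds).eventually_lt_const (half_pos hb)
      filter_upwards [hsmall, self_mem_nhdsWithin] with ε hε hε0 z
      rw [abs_of_nonneg (le_max_right _ _)]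
      refine (max_exp_mul_sub_one_div_le hσ.le (pow_pos hε0 2)).trans ?_
      gcongr)
    (fun z => by
      have h := (tendsto_exp_sq_mul_sub_one_div_sq (σ * z)).max (tendsto_const_nhds (x := (0 : ℝ)))
      simpa only [mul_max_of_nonneg _ _ hσ.le, mul_zero, ← mul_assoc] using h)
  have hden := tendsto_integral_exp_neg_mul_mul_gaussian_mul (a := σ) (m := μ / σ) hb
    (g := fun _ z => σ * max z 0) (fun ε => by fun_prop)
    (.of_forall fun ε z => by
      rw [abs_of_nonneg (by positivity)]
      exact le_mul_of_one_le_right (by positivity) (Real.one_le_exp (by positivity)))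
    (fun z => tendsto_const_nhds)
  have hpos := mul_pos hσ (integral_exp_neg_mul_mul_max_zero_pos hb)
  have hratio := hnum.div hden hpos.ne'
  rw [div_self hpos.ne'] at hratio
  refine hratio.congr' ?_
  filter_upwards [self_mem_nhdsWithin] with ε hε
  replace hε : 0 < ε := hε
  have hlin (I : ℝ) : Real.exp (-k ^ 2 / (2 * ε ^ 2 * σ ^ 2)) * ε * σ * Real.exp k * I =
      Real.exp (-k ^ 2 / (2 * ε ^ 2 * σ ^ 2)) * ε * Real.exp k * (σ * I) := by ring
  rw [hlin, integral_call_payoff_eq σ μ k hσ hε, integral_linearized_payoff_eq σ μ k hσ hε]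
  set A := ∫ z, Real.exp (-(k / σ * z)) * Real.exp (-(ε * (z - μ / σ)) ^ 2 / 2) *
    max ((Real.exp (ε ^ 2 * σ * z) - 1) / ε ^ 2) 0
  set B := ∫ z, Real.exp (-(k / σ * z)) * Real.exp (-(ε * (z - μ / σ)) ^ 2 / 2) * (σ * max z 0)
  have hC : (√(2 * Real.pi))⁻¹ * ε * Real.exp (-k ^ 2 / (2 * ε ^ 2 * σ ^ 2)) * Real.exp k *
      Real.exp (k * μ / σ ^ 2) * ε ^ 2 ≠ 0 := by positivity
  refine (mul_div_mul_left A B hC).symm.trans ?_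
  congr 1
  ring
end

section
/- Fix γ ∈ [0,1) and α ∈ ℝ, and let N be a standard normal random variable. Then for all sufficiently small ε > 0, the quantity Q(ε) := √(2π) · ε^{-2} · E[ exp(−N/ε) · (N + γ·|N| + ε·α)⁺ ] satisfies liminf_{ε→0⁺} Q(ε) ≥ min( (1−γ)·e^{α/(1−γ)} + 2γ , (1+γ)·e^{α/(1+γ)} ) and limsup_{ε→0⁺} Q(ε) ≤ max( (1−γ)·e^{α/(1−γ)} + 2γ , (1+γ)·e^{α/(1+γ)} ). In particular, for γ = 0 one recovers lim_{ε→0⁺} Q(ε) = e^α. -/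
open MeasureTheory ProbabilityTheory Filter

theorem exp_neg_mul_max_zero_eq_indicator :
    (fun z : ℝ => Real.exp (-z) * max z 0) =
      (Set.Ioi (0 : ℝ)).indicator (fun z => Real.exp (-z) * z ^ ((2 : ℝ) - 1)) := by
  funext z
  by_cases hz : z ∈ Set.Ioi (0 : ℝ)
  · rw [Set.indicator_of_mem hz, max_eq_left (le_of_lt hz)]
    norm_num
  · rw [Set.indicator_of_notMem hz, max_eq_right (not_lt.mp hz), mul_zero]

theorem integrable_exp_neg_mul_max_zero :
    Integrable (fun z : ℝ => Real.exp (-z) * max z 0) := by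
  rw [exp_neg_mul_max_zero_eq_indicator, integrable_indicator_iff measurableSet_Ioi]
  exact Real.GammaIntegral_convergent two_pos

theorem integral_exp_neg_mul_max_zero :
    ∫ z : ℝ, Real.exp (-z) * max z 0 = 1 := by
  rw [exp_neg_mul_max_zero_eq_indicator, integral_indicator measurableSet_Ioi,
    ← Real.Gamma_eq_integral two_pos, Real.Gamma_two]

theorem exp_neg_mul_max_affine_eq {c : ℝ} (hc : 0 < c) (α : ℝ) :
    (fun y : ℝ => Real.exp (-y) * max (c * y + α) 0) =
      fun y => c * Real.exp (α / c) * (Real.exp (-(y + α / c)) * max (y + α / c) 0) := by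
  funext y
  have hmax : max (c * y + α) 0 = c * max (y + α / c) 0 := by
    rw [mul_max_of_nonneg _ _ hc.le, mul_zero, mul_add, mul_div_cancel₀ _ hc.ne']
  have hexp : Real.exp (-y) = Real.exp (α / c) * Real.exp (-(y + α / c)) := by
    rw [← Real.exp_add]
    ring_nf
  rw [hmax, hexp]
  ring

theorem integrable_exp_neg_mul_max_affine {c : ℝ} (hc : 0 < c) (α : ℝ) :
    Integrable (fun y : ℝ => Real.exp (-y) * max (c * y + α) 0) := by
  rw [exp_neg_mul_max_affine_eq hc]
  exact (integrable_exp_neg_mul_max_zero.comp_add_right (α / c)).const_mul _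

theorem integral_exp_neg_mul_max_affine {c : ℝ} (hc : 0 < c) (α : ℝ) :
    ∫ y : ℝ, Real.exp (-y) * max (c * y + α) 0 = c * Real.exp (α / c) := by
  rw [exp_neg_mul_max_affine_eq hc, integral_const_mul,
    integral_add_right_eq_self (fun z : ℝ => Real.exp (-z) * max z 0),
    integral_exp_neg_mul_max_zero, mul_one]

theorem max_perturbed_of_nonneg {γ α : ℝ} (hγ : γ ∈ Set.Ico (0 : ℝ) 1) (hα : 0 ≤ α) (y : ℝ) :
    max (y + γ * |y| + α) 0 = max ((1 - γ) * y + α) 0 + 2 * γ * max y 0 := by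
  obtain ⟨h0, h1⟩ := hγ
  rcases le_total 0 y with hy | hy
  · have h : 0 ≤ (1 - γ) * y := mul_nonneg (by linarith) hy
    have h' : 0 ≤ γ * y := mul_nonneg h0 hy
    rw [abs_of_nonneg hy, max_eq_left (by linarith), max_eq_left (by linarith), max_eq_left hy]
    ring
  · rw [abs_of_nonpos hy, max_eq_right hy]
    ring_nf

theorem max_perturbed_of_nonpos {γ α : ℝ} (hγ : γ ∈ Set.Ico (0 : ℝ) 1) (hα : α ≤ 0) (y : ℝ) :
    max (y + γ * |y| + α) 0 = max ((1 + γ) * y + α) 0 := by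
  obtain ⟨h0, h1⟩ := hγ
  rcases le_total 0 y with hy | hy
  · rw [abs_of_nonneg hy]
    ring_nf
  · have h : (1 - γ) * y ≤ 0 := mul_nonpos_of_nonneg_of_nonpos (by linarith) hy
    have h' : (1 + γ) * y ≤ 0 := mul_nonpos_of_nonneg_of_nonpos (by linarith) hy
    rw [abs_of_nonpos hy, max_eq_right (by linarith), max_eq_right (by linarith)]

theorem integrable_and_integral_perturbed_of_nonneg {γ α : ℝ} (hγ : γ ∈ Set.Ico (0 : ℝ) 1) (hα : 0 ≤ α) :
    Integrable (fun y : ℝ => Real.exp (-y) * max (y + γ * |y| + α) 0) ∧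
      ∫ y : ℝ, Real.exp (-y) * max (y + γ * |y| + α) 0 =
        (1 - γ) * Real.exp (α / (1 - γ)) + 2 * γ := by
  have hc : 0 < 1 - γ := sub_pos.mpr hγ.2
  have heq : (fun y : ℝ => Real.exp (-y) * max (y + γ * |y| + α) 0) = fun y =>
      Real.exp (-y) * max ((1 - γ) * y + α) 0 + 2 * γ * (Real.exp (-y) * max y 0) := by
    funext y
    rw [max_perturbed_of_nonneg hγ hα]
    ring
  have hf := integrable_exp_neg_mul_max_affine hc α
  have hg := integrable_exp_neg_mul_max_zero.const_mul (2 * γ)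
  rw [heq]
  refine ⟨hf.add hg, ?_⟩
  rw [integral_add hf hg, integral_const_mul, integral_exp_neg_mul_max_affine hc,
    integral_exp_neg_mul_max_zero, mul_one]

theorem integrable_and_integral_perturbed_of_nonpos {γ α : ℝ} (hγ : γ ∈ Set.Ico (0 : ℝ) 1) (hα : α ≤ 0) :
    Integrable (fun y : ℝ => Real.exp (-y) * max (y + γ * |y| + α) 0) ∧
      ∫ y : ℝ, Real.exp (-y) * max (y + γ * |y| + α) 0 =
        (1 + γ) * Real.exp (α / (1 + γ)) := by
  have hc : 0 < 1 + γ := by linarith [hγ.1]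
  simp_rw [max_perturbed_of_nonpos hγ hα]
  exact ⟨integrable_exp_neg_mul_max_affine hc α, integral_exp_neg_mul_max_affine hc α⟩

/-- The substitution `x = ε y` in the Gaussian expectation. -/
theorem gaussian_laplace_rescale (γ α : ℝ) {ε : ℝ} (hε : 0 < ε) :
    Real.sqrt (2 * Real.pi) * (ε ^ 2)⁻¹ *
        ∫ x, Real.exp (-x / ε) * max (x + γ * |x| + ε * α) 0 ∂(gaussianReal 0 1) =
      ∫ y : ℝ, Real.exp (-(ε * y) ^ 2 / 2) * (Real.exp (-y) * max (y + γ * |y| + α) 0) := by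
  have hs : Real.sqrt (2 * Real.pi) ≠ 0 := (Real.sqrt_pos.mpr (by positivity)).ne'
  set g : ℝ → ℝ := fun x =>
    Real.exp (-x ^ 2 / 2) * (Real.exp (-x / ε) * max (x + γ * |x| + ε * α) 0) with hg
  have hgauss : ∫ x, Real.exp (-x / ε) * max (x + γ * |x| + ε * α) 0 ∂(gaussianReal 0 1) =
      (Real.sqrt (2 * Real.pi))⁻¹ * ∫ x, g x := by
    rw [integral_gaussianReal_eq_integral_smul one_ne_zero, ← integral_const_mul]
    congr 1
    funext x
    simp only [gaussianPDFReal, hg, smul_eq_mul, NNReal.coe_one, mul_one, sub_zero]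
    ring
  have hscale : ∫ x, g x = ε * ∫ y, g (ε * y) := by
    rw [Measure.integral_comp_mul_left, abs_of_pos (inv_pos.mpr hε), smul_eq_mul,
      mul_inv_cancel_left₀ hε.ne']
  have hpoint : ∀ y, g (ε * y) = ε *
      (Real.exp (-(ε * y) ^ 2 / 2) * (Real.exp (-y) * max (y + γ * |y| + α) 0)) := by
    intro y
    have hmax : max (ε * y + γ * |ε * y| + ε * α) 0 = ε * max (y + γ * |y| + α) 0 := by
      rw [mul_max_of_nonneg _ _ hε.le, mul_zero, abs_mul, abs_of_pos hε]
      ring_nf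
    have hdiv : -(ε * y) / ε = -y := by
      field_simp
    simp only [hg]
    rw [hmax, hdiv]
    ring
  rw [hgauss, hscale]
  simp_rw [hpoint]
  rw [integral_const_mul]
  field_simp

theorem tendsto_integral_gaussian_damping {f : ℝ → ℝ} (hf : Integrable f) :
    Tendsto (fun ε : ℝ => ∫ y : ℝ, Real.exp (-(ε * y) ^ 2 / 2) * f y)
      (nhdsWithin 0 (Set.Ioi 0)) (nhds (∫ y, f y)) := by
  refine tendsto_integral_filter_of_dominated_convergence (fun y => ‖f y‖) ?_ ?_ hf.norm ?_
  · refine Eventually.of_forall fun ε => AEStronglyMeasurable.mul ?_ hf.aestronglyMeasurable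
    exact Continuous.aestronglyMeasurable (by fun_prop)
  · refine Eventually.of_forall fun ε => Eventually.of_forall fun y => ?_
    rw [norm_mul, Real.norm_eq_abs, Real.abs_exp]
    refine mul_le_of_le_one_left (norm_nonneg _) (Real.exp_le_one_iff.mpr ?_)
    linarith [sq_nonneg (ε * y)]
  · refine Eventually.of_forall fun y => ?_
    have hcont : Continuous fun ε : ℝ => Real.exp (-(ε * y) ^ 2 / 2) * f y := by fun_prop
    have h := (hcont.tendsto 0).mono_left (nhdsWithin_le_nhds (s := Set.Ioi 0))
    simpa using h

theorem tendsto_gaussian_laplace {γ α : ℝ}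
    (hint : Integrable (fun y : ℝ => Real.exp (-y) * max (y + γ * |y| + α) 0)) :
    Tendsto
      (fun ε : ℝ => Real.sqrt (2 * Real.pi) * (ε ^ 2)⁻¹ *
        ∫ x, Real.exp (-x / ε) * max (x + γ * |x| + ε * α) 0 ∂(gaussianReal 0 1))
      (nhdsWithin 0 (Set.Ioi 0))
      (nhds (∫ y : ℝ, Real.exp (-y) * max (y + γ * |y| + α) 0)) := by
  refine (tendsto_integral_gaussian_damping hint).congr' ?_
  filter_upwards [self_mem_nhdsWithin] with ε hε
  exact (gaussian_laplace_rescale γ α hε).symm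

/-- Asymptotic sandwich from Lemma lem:BSabs: for fixed `γ ∈ [0,1)` and `α ∈ ℝ`,
`Q(ε) := √(2π) ε⁻² E[exp(−N/ε)(N + γ|N| + εα)⁺]` satisfies
`min((1−γ)e^{α/(1−γ)} + 2γ, (1+γ)e^{α/(1+γ)}) ≤ liminf Q ≤ limsup Q ≤ max(...)`;
in particular for `γ = 0` one has `Q(ε) → e^α`. -/
theorem gaussian_laplace_sandwich (γ α : ℝ) (hγ : γ ∈ Set.Ico (0 : ℝ) 1) :
    (min ((1 - γ) * Real.exp (α / (1 - γ)) + 2 * γ)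
        ((1 + γ) * Real.exp (α / (1 + γ)))
      ≤ liminf
          (fun ε : ℝ => Real.sqrt (2 * Real.pi) * (ε ^ 2)⁻¹ *
            ∫ x, Real.exp (-x / ε) * max (x + γ * |x| + ε * α) 0 ∂(gaussianReal 0 1))
          (nhdsWithin 0 (Set.Ioi 0))) ∧
    (limsup
        (fun ε : ℝ => Real.sqrt (2 * Real.pi) * (ε ^ 2)⁻¹ *
          ∫ x, Real.exp (-x / ε) * max (x + γ * |x| + ε * α) 0 ∂(gaussianReal 0 1))
        (nhdsWithin 0 (Set.Ioi 0))
      ≤ max ((1 - γ) * Real.exp (α / (1 - γ)) + 2 * γ)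
          ((1 + γ) * Real.exp (α / (1 + γ)))) ∧
    (γ = 0 →
      Tendsto
        (fun ε : ℝ => Real.sqrt (2 * Real.pi) * (ε ^ 2)⁻¹ *
          ∫ x, Real.exp (-x / ε) * max (x + γ * |x| + ε * α) 0 ∂(gaussianReal 0 1))
        (nhdsWithin 0 (Set.Ioi 0)) (nhds (Real.exp α))) := by
  rcases le_total 0 α with hα | hα
  · obtain ⟨hint, hval⟩ := integrable_and_integral_perturbed_of_nonneg hγ hα
    have hlim := tendsto_gaussian_laplace hint
    rw [hval] at hlim
    refine ⟨(min_le_left _ _).trans hlim.liminf_eq.ge,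
      hlim.limsup_eq.le.trans (le_max_left _ _), ?_⟩
    rintro rfl
    simpa using hlim
  · obtain ⟨hint, hval⟩ := integrable_and_integral_perturbed_of_nonpos hγ hα
    have hlim := tendsto_gaussian_laplace hint
    rw [hval] at hlim
    refine ⟨(min_le_right _ _).trans hlim.liminf_eq.ge,
      hlim.limsup_eq.le.trans (le_max_right _ _), ?_⟩
    rintro rfl
    simpa using hlim
end
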